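/- arXiv:2407.20355 — 4 statements merged into one kernel-verified Lean document; each statement's English description precedes it below -/
import Mathlib

section
/- Let G be a finite group acting faithfully and transitively on a finite nonempty set Ω, let p be an odd prime dividing |G|, and let P be a Sylow p-subgroup of G. Then the number of orbits of P on Ω is at most (p/(2p−1))·|Ω|. -/
open Pointwise

/-- If `y` has `p`-power order and normalizes a subgroup `J` containing a Sylow `p`-subgroup, then
`y` lies in `J`. -/
theorem Sylow.mem_of_conj_smul_eq {G : Type*} [Group G] [Finite G] {p : ℕ} [Fact p.Prime]
    (Q P : Sylow p G) {J : Subgroup G} (hQ : (Q : Subgroup G) ≤ J) {y : G} (hy : y ∈ P)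
    (hyJ : MulAut.conj y • J = J) : y ∈ J := by
  have hyN : y ∈ Subgroup.normalizer (J : Set G) := by
    rw [Subgroup.mem_normalizer_iff]
    intro h
    rw [← MulAut.conj_apply, ← MulAut.smul_def]
    nth_rewrite 2 [← hyJ]
    rw [Subgroup.smul_mem_pointwise_smul_iff]
  set N := Subgroup.normalizer (J : Set G)
  let z : N ⧸ J.subgroupOf N := QuotientGroup.mk ⟨y, hyN⟩
  obtain ⟨k, hk⟩ := P.isPGroup' ⟨y, hy⟩
  have h1 : orderOf z ∣ p ^ k := by
    rw [orderOf_dvd_iff_pow_eq_one]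
    have : y ^ p ^ k = 1 := by simpa using congrArg Subtype.val hk
    have h2 : (⟨y, hyN⟩ : N) ^ p ^ k = 1 := Subtype.ext (by simpa using this)
    rw [← QuotientGroup.mk_pow, h2, QuotientGroup.mk_one]
  have h2 : orderOf z ∣ (J.subgroupOf N).index := orderOf_dvd_natCard z
  have h3 : ¬ p ∣ (J.subgroupOf N).index := fun h =>
    Q.not_dvd_index <| h.trans <| (Subgroup.relIndex_dvd_index_of_le Subgroup.le_normalizer).trans
      (Subgroup.index_dvd_of_le hQ)
  have h4 : orderOf z = 1 := Nat.eq_one_of_dvd_coprimes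
    (((Nat.Prime.coprime_iff_not_dvd Fact.out).2 h3).pow_left k) h1 h2
  rw [orderOf_eq_one_iff, QuotientGroup.eq_one_iff, Subgroup.mem_subgroupOf] at h4
  exact h4

/-- An orbit of a `p`-group which is not a fixed point has at least `p` points. -/
theorem IsPGroup.le_card_orbit {H Ω : Type*} [Group H] [Finite Ω] [MulAction H Ω] {p : ℕ}
    [Fact p.Prime] (hH : IsPGroup p H) {a : Ω} (ha : a ∉ MulAction.fixedPoints H Ω) :
    p ≤ Nat.card (MulAction.orbit H a) := by
  obtain ⟨k, hk⟩ := hH.card_orbit a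
  have := Fintype.ofFinite (MulAction.orbit H a)
  rw [hk]
  rcases Nat.eq_zero_or_pos k with rfl | hk0
  · refine absurd (MulAction.mem_fixedPoints_iff_card_orbit_eq_one.2 ?_) ha
    rw [← Nat.card_eq_fintype_card, hk, pow_zero]
  · exact Nat.le_self_pow hk0.ne' p

/-- A nonempty set of subgroups, invariant under conjugation by a Sylow `p`-subgroup that fixes
none of its members, has at least `p` members. -/
theorem Sylow.le_card_of_conj_invariant {G : Type*} [Group G] [Finite G] {p : ℕ} [Fact p.Prime]
    (P : Sylow p G) {X : Finset (Subgroup G)} (hX : X.Nonempty)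
    (hinv : ∀ g ∈ P, ∀ B ∈ X, MulAut.conj g • B ∈ X)
    (hfix : ∀ B ∈ X, ∃ g ∈ P, MulAut.conj g • B ≠ B) : p ≤ X.card := by
  let : MulAction P (Subgroup G) :=
    MulAction.compHom (Subgroup G) (MulAut.conj.comp (P : Subgroup G).subtype)
  obtain ⟨B, hB⟩ := hX
  have h1 : B ∉ MulAction.fixedPoints P (Subgroup G) := fun h => by
    obtain ⟨g, hg, hgB⟩ := hfix B hB
    exact hgB (h ⟨g, hg⟩)
  have h2 : MulAction.orbit P B ⊆ X := by
    rintro _ ⟨g, rfl⟩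
    exact hinv g g.2 B hB
  calc p ≤ Nat.card (MulAction.orbit P B) := P.isPGroup'.le_card_orbit h1
    _ ≤ Nat.card X := Nat.card_mono X.finite_toSet h2
    _ = X.card := by simp

/-- The subgroup generated by the Sylow `p`-subgroups of the whole group contained in `L`. -/
def sylowCore {G : Type*} [Group G] (p : ℕ) (L : Subgroup G) : Subgroup G :=
  ⨆ Q : Sylow p G, ⨆ _ : (Q : Subgroup G) ≤ L, (Q : Subgroup G)

section Core

variable {G : Type*} [Group G] {p : ℕ}

theorem sylowCore_le (L : Subgroup G) : sylowCore p L ≤ L :=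
  iSup₂_le fun _ h => h

theorem Sylow.le_sylowCore_iff {Q : Sylow p G} {L : Subgroup G} :
    (Q : Subgroup G) ≤ sylowCore p L ↔ (Q : Subgroup G) ≤ L :=
  ⟨fun h => h.trans (sylowCore_le L),
    fun h => le_iSup₂_of_le (f := fun (Q : Sylow p G) (_ : (Q : Subgroup G) ≤ L) =>
      (Q : Subgroup G)) Q h le_rfl⟩

theorem sylowCore_le_iff {L M : Subgroup G} :
    sylowCore p L ≤ M ↔ ∀ Q : Sylow p G, (Q : Subgroup G) ≤ L → (Q : Subgroup G) ≤ M :=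
  iSup₂_le_iff

theorem sylowCore_sylowCore (L : Subgroup G) : sylowCore p (sylowCore p L) = sylowCore p L :=
  le_antisymm (sylowCore_le _) (sylowCore_le_iff.2 fun _ h =>
    Sylow.le_sylowCore_iff.2 (Sylow.le_sylowCore_iff.2 h))

theorem conj_mul_smul (g h : G) (L : Subgroup G) :
    MulAut.conj (g * h) • L = MulAut.conj g • MulAut.conj h • L := by
  rw [map_mul, mul_smul]

theorem conj_inv_smul_smul (g : G) (L : Subgroup G) :
    MulAut.conj g⁻¹ • MulAut.conj g • L = L := by
  rw [← conj_mul_smul, inv_mul_cancel, map_one, one_smul]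

theorem Sylow.inv_smul_le_iff {Q : Sylow p G} {g : G} {L : Subgroup G} :
    ((g⁻¹ • Q : Sylow p G) : Subgroup G) ≤ L ↔ (Q : Subgroup G) ≤ MulAut.conj g • L := by
  rw [Sylow.coe_subgroup_smul, Subgroup.pointwise_smul_subset_iff, map_inv, inv_inv]

theorem conj_smul_sylowCore (g : G) (L : Subgroup G) :
    MulAut.conj g • sylowCore p L = sylowCore p (MulAut.conj g • L) := by
  have key : ∀ (g : G) (L : Subgroup G),
      sylowCore p (MulAut.conj g • L) ≤ MulAut.conj g • sylowCore p L := fun g L =>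
    sylowCore_le_iff.2 fun Q hQ => by
      rw [← Sylow.inv_smul_le_iff] at hQ ⊢
      exact Sylow.le_sylowCore_iff.2 hQ
  refine le_antisymm ?_ (key g L)
  have h := key g⁻¹ (MulAut.conj g • L)
  rw [conj_inv_smul_smul] at h
  rwa [Subgroup.pointwise_smul_subset_iff, ← map_inv]

end Core

section Family

variable {G : Type*} [Group G] {p : ℕ}

open Classical in
/-- The weight `-p` if `P ≤ L` and `p - 1` otherwise. -/
noncomputable def sylowWeight (P : Sylow p G) (L : Subgroup G) : ℤ :=
  if (P : Subgroup G) ≤ L then -p else p - 1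

/-- The total weight of a family of subgroups, given by its multiplicity function. -/
noncomputable def sylowExcess [Fintype (Subgroup G)] (P : Sylow p G) (m : Subgroup G → ℕ) : ℤ :=
  ∑ L, m L * sylowWeight P L

/-- A family of proper subgroups of `K`, invariant under conjugation by `K`, each of which is
generated by a nonempty set of Sylow `p`-subgroups of the whole group. -/
structure IsSylowFamily (p : ℕ) (K : Subgroup G) (m : Subgroup G → ℕ) : Prop where
  conj : ∀ g ∈ K, ∀ L, m (MulAut.conj g • L) = m L
  lt : ∀ L, m L ≠ 0 → L < K
  core : ∀ L, m L ≠ 0 → sylowCore p L = L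
  exists_le : ∀ L, m L ≠ 0 → ∃ Q : Sylow p G, (Q : Subgroup G) ≤ L

/-- No Sylow `p`-subgroup contained in `K` is contained in all members of `W`. -/
def IsSylowSpanning (p : ℕ) (K : Subgroup G) (W : Finset (Subgroup G)) : Prop :=
  ∀ Q : Sylow p G, (Q : Subgroup G) ≤ K → ∃ L ∈ W, ¬ (Q : Subgroup G) ≤ L

open Classical in
/-- The multiplicity function of a finite set of subgroups. -/
noncomputable def multOne (Y : Finset (Subgroup G)) (L : Subgroup G) : ℕ := if L ∈ Y then 1 else 0

theorem multOne_ne_zero {Y : Finset (Subgroup G)} {L : Subgroup G} : multOne Y L ≠ 0 ↔ L ∈ Y := by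
  simp [multOne]

theorem conj_invariant_of_le {K : Subgroup G} {m : Subgroup G → ℕ}
    (h : ∀ g ∈ K, ∀ L, m L ≤ m (MulAut.conj g • L)) :
    ∀ g ∈ K, ∀ L, m (MulAut.conj g • L) = m L := fun g hg L => by
  refine le_antisymm ?_ (h g hg L)
  have := h g⁻¹ (K.inv_mem hg) (MulAut.conj g • L)
  rwa [conj_inv_smul_smul] at this

theorem sylowWeight_congr {P Q : Sylow p G} {L M : Subgroup G}
    (h : (P : Subgroup G) ≤ L ↔ (Q : Subgroup G) ≤ M) : sylowWeight P L = sylowWeight Q M := by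
  unfold sylowWeight
  congr 1
  exact propext h

theorem sylowWeight_smul (P : Sylow p G) (g : G) (L : Subgroup G) :
    sylowWeight (g • P) (MulAut.conj g • L) = sylowWeight P L :=
  sylowWeight_congr <| by
    rw [Sylow.coe_subgroup_smul, Subgroup.pointwise_smul_le_pointwise_smul_iff]

theorem sylowExcess_multOne [Fintype (Subgroup G)] (P : Sylow p G) (Y : Finset (Subgroup G)) :
    sylowExcess P (multOne Y) = ∑ L ∈ Y, sylowWeight P L := by
  simp [sylowExcess, multOne]

theorem sylowExcess_eq [Finite G] [Fact p.Prime] [Fintype (Subgroup G)] {K : Subgroup G}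
    {m : Subgroup G → ℕ} (hm : IsSylowFamily p K m) {P Q : Sylow p G} (hP : (P : Subgroup G) ≤ K)
    (hQ : (Q : Subgroup G) ≤ K) : sylowExcess P m = sylowExcess Q m := by
  obtain ⟨g, hg⟩ := MulAction.exists_smul_eq K (P.subtype hP) (Q.subtype hQ)
  rw [Sylow.smul_subtype] at hg
  obtain rfl : (g : G) • P = Q := Sylow.subtype_injective hg
  symm
  unfold sylowExcess
  rw [← Equiv.sum_comp (MulAction.toPerm (MulAut.conj (g : G)))]
  refine Finset.sum_congr rfl fun L _ => ?_
  rw [MulAction.toPerm_apply, hm.conj g g.2, sylowWeight_smul]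

/-- A nonempty family has a spanning set of at most `p` members: the conjugates of a member under
the powers of an element `y` that does not normalize it while `y ^ p` does. -/
theorem exists_isSylowSpanning [Finite G] [Fact p.Prime] {K : Subgroup G} {m : Subgroup G → ℕ}
    (hK : sylowCore p K = K) (hm : IsSylowFamily p K m) {B : Subgroup G} (hB : m B ≠ 0) :
    ∃ W : Finset (Subgroup G), (∀ L ∈ W, m L ≠ 0) ∧ IsSylowSpanning p K W ∧ W.card ≤ p := by
  classical
  have hp : p.Prime := Fact.out
  obtain ⟨Q, hQ⟩ := hm.exists_le B hB
  obtain ⟨P, hPK, hPB⟩ : ∃ P : Sylow p G, (P : Subgroup G) ≤ K ∧ ¬ (P : Subgroup G) ≤ B := by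
    by_contra! h
    exact (hm.lt B hB).not_ge (hK ▸ sylowCore_le_iff.2 h)
  obtain ⟨x, hxP, hxB⟩ := SetLike.not_le_iff_exists.1 hPB
  have hxfix : MulAut.conj x • B ≠ B := fun h => hxB (Q.mem_of_conj_smul_eq P hQ hxP h)
  have hex : ∃ k : ℕ, MulAut.conj (x ^ p ^ k) • B = B := by
    obtain ⟨k, hk⟩ := P.isPGroup' ⟨x, hxP⟩
    have : x ^ p ^ k = 1 := by simpa using congrArg Subtype.val hk
    exact ⟨k, by rw [this, map_one, one_smul]⟩
  obtain ⟨y, hyP, hyB, hypB⟩ : ∃ y ∈ P, MulAut.conj y • B ≠ B ∧ MulAut.conj (y ^ p) • B = B := by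
    obtain ⟨n, hn⟩ : ∃ n, Nat.find hex = n + 1 := Nat.exists_eq_succ_of_ne_zero fun h0 => by
      have := Nat.find_spec hex
      rw [h0, pow_zero, pow_one] at this
      exact hxfix this
    refine ⟨x ^ p ^ n, pow_mem hxP _, Nat.find_min hex (by omega), ?_⟩
    rw [← pow_mul, ← pow_succ, ← hn]
    exact Nat.find_spec hex
  refine ⟨(Finset.range p).image fun i => MulAut.conj (y ^ i) • B, ?_, ?_, ?_⟩
  · intro L hL
    obtain ⟨i, -, rfl⟩ := Finset.mem_image.1 hL
    rwa [hm.conj _ (pow_mem (hPK hyP) i)]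
  · intro R hRK
    by_contra! h
    have hstab (j : ℤ) : MulAut.conj ((y ^ p) ^ j) • B = B := by
      rw [map_zpow]
      exact (MulAction.stabilizer (MulAut G) B).zpow_mem (x := MulAut.conj (y ^ p)) hypB j
    have hR (i : ℤ) : (R : Subgroup G) ≤ MulAut.conj (y ^ i) • B := by
      have hp0 : (p : ℤ) ≠ 0 := by exact_mod_cast hp.ne_zero
      have h0 := Int.emod_nonneg i hp0
      have h1 := Int.emod_lt_of_pos i (by exact_mod_cast hp.pos : (0 : ℤ) < p)
      have h2 : y ^ i = y ^ (i % p).toNat * (y ^ p) ^ (i / p) := by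
        rw [← zpow_natCast, ← zpow_natCast, ← zpow_mul, ← zpow_add, Int.toNat_of_nonneg h0,
          Int.emod_add_mul_ediv]
      rw [h2, conj_mul_smul, hstab]
      exact h _ (Finset.mem_image_of_mem _ (Finset.mem_range.2 (by omega)))
    let J : Subgroup G := ⨅ i : ℤ, MulAut.conj (y ^ i) • B
    have hJ (k : ℤ) : MulAut.conj (y ^ k) • J ≤ J := le_iInf fun i => by
      rw [Subgroup.pointwise_smul_subset_iff, ← map_inv, ← conj_mul_smul, ← zpow_neg, ← zpow_add]
      exact iInf_le _ _
    have hyJ : y ∈ J := by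
      have h1 := hJ 1
      rw [zpow_one] at h1
      refine R.mem_of_conj_smul_eq P (le_iInf hR) hyP (le_antisymm h1 ?_)
      have := hJ (-1)
      rwa [Subgroup.pointwise_smul_subset_iff, ← map_inv, ← zpow_neg, neg_neg, zpow_one] at this
    have hyB' : y ∈ B := by simpa using (iInf_le (fun i : ℤ => MulAut.conj (y ^ i) • B) 0) hyJ
    exact hyB (Subgroup.conj_smul_eq_self_of_mem hyB')
  · exact Finset.card_image_le.trans (Finset.card_range p).le

/-- The lower bound for the excess of a family, in terms of spanning subsets. -/
def SylowExcessBound [Fintype (Subgroup G)] (p : ℕ) (K : Subgroup G) : Prop :=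
  ∀ m : Subgroup G → ℕ, IsSylowFamily p K m → ∀ W : Finset (Subgroup G), (∀ L ∈ W, m L ≠ 0) →
    IsSylowSpanning p K W → ∀ P : Sylow p G, (P : Subgroup G) ≤ K →
      (p : ℤ) ^ 2 ≤ sylowExcess P m + p * W.card

/-- The excess of every family is nonnegative. -/
def SylowExcessNonneg [Fintype (Subgroup G)] (p : ℕ) (K : Subgroup G) : Prop :=
  ∀ m : Subgroup G → ℕ, IsSylowFamily p K m → ∀ P : Sylow p G, (P : Subgroup G) ≤ K →
    0 ≤ sylowExcess P m

/-- The lower bound for the excess of an invariant antichain, given the bounds below `K`. -/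
theorem IsSylowFamily.le_sylowExcess_multOne [Finite G] [Fact p.Prime] [Fintype (Subgroup G)]
    {K : Subgroup G}
    (ih : ∀ A < K, sylowCore p A = A → SylowExcessBound p A ∧ SylowExcessNonneg p A)
    {Y : Finset (Subgroup G)} (hY : IsSylowFamily p K (multOne Y))
    (hanti : IsAntichain (· ≤ ·) (Y : Set (Subgroup G))) {W : Finset (Subgroup G)} (hWY : W ⊆ Y)
    (hW : IsSylowSpanning p K W) {P : Sylow p G} (hPK : (P : Subgroup G) ≤ K) :
    (p : ℤ) ^ 2 ≤ sylowExcess P (multOne Y) + p * W.card := by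
  classical
  have hp : p.Prime := Fact.out
  obtain ⟨A, hAW, -⟩ := hW P hPK
  have hAY := hWY hAW
  have hA := multOne_ne_zero.2 hAY
  have hAK := hY.lt A hA
  obtain ⟨Q, hQA⟩ := hY.exists_le A hA
  have hQK := hQA.trans hAK.le
  rw [sylowExcess_eq hY hPK hQK, sylowExcess_multOne]
  obtain ⟨ihS, ihN⟩ := ih A hAK (hY.core A hA)
  have hmemY {g : G} (hg : g ∈ A) {B : Subgroup G} (hB : B ∈ Y.erase A) :
      MulAut.conj g • B ∈ Y.erase A := by
    rw [Finset.mem_erase] at hB ⊢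
    refine ⟨fun h => hB.1 ?_, ?_⟩
    · rw [← Subgroup.conj_smul_eq_self_of_mem hg] at h
      exact smul_left_cancel _ h
    · rw [← multOne_ne_zero, hY.conj g (hAK.le hg), multOne_ne_zero]
      exact hB.2
  let E : Subgroup G → Prop := fun B => ∃ R : Sylow p G, (R : Subgroup G) ≤ B ⊓ A
  have hE {g : G} (hg : g ∈ A) {B : Subgroup G} (hB : E B) : E (MulAut.conj g • B) := by
    obtain ⟨R, hR⟩ := hB
    refine ⟨g • R, ?_⟩
    rw [Sylow.coe_subgroup_smul]
    have h : MulAut.conj g • (B ⊓ A) = MulAut.conj g • B ⊓ A := by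
      rw [Subgroup.smul_inf, Subgroup.conj_smul_eq_self_of_mem hg]
    rwa [← h, Subgroup.pointwise_smul_le_pointwise_smul_iff]
  have hE' {g : G} (hg : g ∈ A) {B : Subgroup G} (hB : E (MulAut.conj g • B)) : E B := by
    simpa only [conj_inv_smul_smul] using hE (A.inv_mem hg) hB
  let Y₁ := (Y.erase A).filter E
  let Y₂ := (Y.erase A).filter fun B => ¬ E B
  let r : Subgroup G → Subgroup G := fun B => sylowCore p (B ⊓ A)
  let m : Subgroup G → ℕ := fun C => (Y₁.filter fun B => r B = C).card
  have hm0 {C : Subgroup G} (hC : m C ≠ 0) : ∃ B ∈ Y, B ≠ A ∧ E B ∧ r B = C := by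
    obtain ⟨B, hB⟩ := Finset.card_ne_zero.1 hC
    simp only [Y₁, Finset.mem_filter, Finset.mem_erase] at hB
    exact ⟨B, hB.1.1.2, hB.1.1.1, hB.1.2, hB.2⟩
  have hm : IsSylowFamily p A m := by
    refine ⟨conj_invariant_of_le fun g hg L => ?_, fun C hC => ?_, fun C hC => ?_, fun C hC => ?_⟩
    · refine Finset.card_le_card_of_injOn (fun B => MulAut.conj g • B) (fun B hB => ?_)
        fun B _ C _ h => smul_left_cancel _ h
      simp only [Y₁, Finset.mem_coe, Finset.mem_filter] at hB ⊢
      refine ⟨⟨hmemY hg hB.1.1, hE hg hB.1.2⟩, ?_⟩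
      rw [← hB.2]
      simp only [r]
      rw [conj_smul_sylowCore, Subgroup.smul_inf, Subgroup.conj_smul_eq_self_of_mem hg]
    · obtain ⟨B, hBY, hBA, -, rfl⟩ := hm0 hC
      refine lt_of_le_of_ne ((sylowCore_le _).trans inf_le_right) fun h => ?_
      have : A ≤ B := h.symm.le.trans ((sylowCore_le _).trans inf_le_left)
      exact hanti hAY hBY hBA.symm this
    · obtain ⟨B, -, -, -, rfl⟩ := hm0 hC
      exact sylowCore_sylowCore _
    · obtain ⟨B, -, -, ⟨R, hR⟩, rfl⟩ := hm0 hC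
      exact ⟨R, Sylow.le_sylowCore_iff.2 hR⟩
  have hsum₁ : ∑ B ∈ Y₁, sylowWeight Q B = sylowExcess Q m := by
    have h1 : ∀ B ∈ Y₁, sylowWeight Q B = sylowWeight Q (r B) := fun B _ =>
      sylowWeight_congr <| by
        rw [Sylow.le_sylowCore_iff]
        exact ⟨fun h => le_inf h hQA, fun h => h.trans inf_le_left⟩
    rw [Finset.sum_congr rfl h1, ← Finset.sum_fiberwise Y₁ r]
    refine Finset.sum_congr rfl fun C _ => ?_
    rw [Finset.sum_congr rfl fun B hB => by rw [(Finset.mem_filter.1 hB).2], Finset.sum_const,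
      nsmul_eq_mul]
  have hsum₂ : ∑ B ∈ Y₂, sylowWeight Q B = Y₂.card * (p - 1) := by
    have h1 : ∀ B ∈ Y₂, sylowWeight Q B = p - 1 := fun B hB => if_neg fun h =>
      (Finset.mem_filter.1 hB).2 ⟨Q, le_inf h hQA⟩
    rw [Finset.sum_congr rfl h1, Finset.sum_const, nsmul_eq_mul]
  have hsum : ∑ B ∈ Y, sylowWeight Q B = -p + sylowExcess Q m + Y₂.card * (p - 1) := by
    rw [← Finset.add_sum_erase _ _ hAY, ← Finset.sum_filter_add_sum_filter_not (Y.erase A) E,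
      hsum₁, hsum₂, add_assoc]
    congr 1
    exact if_pos hQA
  rw [hsum]
  rcases Y₂.eq_empty_or_nonempty with h2 | h2
  · have h2' {B : Subgroup G} (hB : B ∈ Y.erase A) : E B := by
      by_contra h
      exact Finset.notMem_empty B (h2 ▸ Finset.mem_filter.2 ⟨hB, h⟩)
    have h3 := ihS m hm ((W.erase A).image r) (fun C hC => by
      obtain ⟨B, hB, rfl⟩ := Finset.mem_image.1 hC
      have hB' := Finset.erase_subset_erase A hWY hB
      exact Finset.card_ne_zero.2
        ⟨B, Finset.mem_filter.2 ⟨Finset.mem_filter.2 ⟨hB', h2' hB'⟩, rfl⟩⟩) (fun R hR => by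
      obtain ⟨L, hL, hRL⟩ := hW R (hR.trans hAK.le)
      refine ⟨r L, Finset.mem_image_of_mem r (Finset.mem_erase.2 ⟨fun h => hRL (h ▸ hR), hL⟩), ?_⟩
      exact fun h => hRL ((Sylow.le_sylowCore_iff.1 h).trans inf_le_left)) Q hQA
    have h4 : (((W.erase A).image r).card : ℤ) + 1 ≤ W.card := by
      have := Finset.card_image_le (s := W.erase A) (f := r)
      have := Finset.card_erase_add_one hAW
      omega
    rw [h2, Finset.card_empty]
    have h5 := mul_le_mul_of_nonneg_left h4 (Int.natCast_nonneg p)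
    push_cast
    linarith
  · have h3 := ihN m hm Q hQA
    have h4 : (p : ℤ) ≤ Y₂.card := by
      refine Int.ofNat_le.2 (Q.le_card_of_conj_invariant h2 (fun g hg B hB => ?_) fun B hB => ?_)
      · obtain ⟨hBY, hBE⟩ := Finset.mem_filter.1 hB
        exact Finset.mem_filter.2 ⟨hmemY (hQA hg) hBY, fun h => hBE (hE' (hQA hg) h)⟩
      · obtain ⟨hBY, hBE⟩ := Finset.mem_filter.1 hB
        obtain ⟨R, hR⟩ := hY.exists_le B (multOne_ne_zero.2 (Finset.mem_of_mem_erase hBY))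
        by_contra! h
        exact hBE ⟨Q, le_inf (fun g hg => R.mem_of_conj_smul_eq Q hR hg (h g hg)) hQA⟩
    have h5 : (2 : ℤ) ≤ W.card := by
      obtain ⟨L, hL, hQL⟩ := hW Q hQK
      have : 1 < W.card := Finset.one_lt_card.2 ⟨A, hAW, L, hL, fun h => hQL (h ▸ hQA)⟩
      omega
    have hp1 : (2 : ℤ) ≤ p := by exact_mod_cast hp.two_le
    nlinarith

open Classical in
/-- The minimal members of a family of subgroups. -/
noncomputable def minimalMembers [Fintype (Subgroup G)] (m : Subgroup G → ℕ) :
    Finset (Subgroup G) :=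
  Finset.univ.filter (Minimal fun L => m L ≠ 0)

section Minimal

variable [Fintype (Subgroup G)] {m : Subgroup G → ℕ}

theorem mem_minimalMembers {L : Subgroup G} :
    L ∈ minimalMembers m ↔ Minimal (fun L => m L ≠ 0) L := by
  simp [minimalMembers]

theorem isAntichain_minimalMembers (m : Subgroup G → ℕ) :
    IsAntichain (· ≤ ·) (minimalMembers m : Set (Subgroup G)) := fun _ hA _ hB hAB h =>
  hAB ((mem_minimalMembers.1 hB).eq_of_le (mem_minimalMembers.1 hA).prop h)

theorem exists_minimalMembers_le {B : Subgroup G} (hB : m B ≠ 0) :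
    ∃ A ∈ minimalMembers m, A ≤ B := by
  obtain ⟨A, hAB, hA⟩ := exists_minimal_le_of_wellFoundedLT (fun L => m L ≠ 0) B hB
  exact ⟨A, mem_minimalMembers.2 hA, hAB⟩

theorem multOne_minimalMembers_le (L : Subgroup G) : multOne (minimalMembers m) L ≤ m L := by
  unfold multOne
  split_ifs with h
  · exact Nat.one_le_iff_ne_zero.2 (mem_minimalMembers.1 h).prop
  · exact Nat.zero_le _

variable {K : Subgroup G}

theorem IsSylowFamily.conj_mem_minimalMembers (hm : IsSylowFamily p K m) {g : G} (hg : g ∈ K)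
    {L : Subgroup G} (hL : L ∈ minimalMembers m) : MulAut.conj g • L ∈ minimalMembers m := by
  rw [mem_minimalMembers] at hL ⊢
  refine ⟨(hm.conj g hg L).trans_ne hL.prop, fun M hM hML => ?_⟩
  have h1 := (hm.conj g⁻¹ (K.inv_mem hg) M).trans_ne hM
  rw [Subgroup.pointwise_smul_subset_iff, ← map_inv]
  refine hL.le_of_le h1 ?_
  rwa [Subgroup.pointwise_smul_subset_iff, ← map_inv, inv_inv]

theorem IsSylowFamily.multOne_minimalMembers (hm : IsSylowFamily p K m) :
    IsSylowFamily p K (multOne (minimalMembers m)) := by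
  have h0 {L : Subgroup G} (h : multOne (minimalMembers m) L ≠ 0) : m L ≠ 0 :=
    (mem_minimalMembers.1 (multOne_ne_zero.1 h)).prop
  refine ⟨conj_invariant_of_le fun g hg L => ?_, fun L h => hm.lt L (h0 h),
    fun L h => hm.core L (h0 h), fun L h => hm.exists_le L (h0 h)⟩
  by_cases hL : L ∈ minimalMembers m
  · rw [multOne, multOne, if_pos hL, if_pos (hm.conj_mem_minimalMembers hg hL)]
  · rw [multOne, if_neg hL]
    exact Nat.zero_le _

theorem IsSylowFamily.sub_multOne_minimalMembers (hm : IsSylowFamily p K m) :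
    IsSylowFamily p K fun L => m L - multOne (minimalMembers m) L := by
  have h0 {L : Subgroup G} (h : m L - multOne (minimalMembers m) L ≠ 0) : m L ≠ 0 := by omega
  exact ⟨fun g hg L => by rw [hm.conj g hg, hm.multOne_minimalMembers.conj g hg],
    fun L h => hm.lt L (h0 h), fun L h => hm.core L (h0 h), fun L h => hm.exists_le L (h0 h)⟩

theorem sylowExcess_eq_add (P : Sylow p G) (m : Subgroup G → ℕ) :
    sylowExcess P m = sylowExcess P (multOne (minimalMembers m)) +
      sylowExcess P fun L => m L - multOne (minimalMembers m) L := by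
  unfold sylowExcess
  rw [← Finset.sum_add_distrib]
  refine Finset.sum_congr rfl fun L _ => ?_
  rw [Nat.cast_sub (multOne_minimalMembers_le L)]
  ring

theorem sylowExcessNonneg_of_lt [Finite G] [Fact p.Prime] (hK : sylowCore p K = K)
    (ih : ∀ A < K, sylowCore p A = A → SylowExcessBound p A ∧ SylowExcessNonneg p A) :
    SylowExcessNonneg p K := by
  intro m hm P hP
  induction hn : ∑ L, m L using Nat.strong_induction_on generalizing m with
  | _ n ihn =>
    by_cases h0 : ∀ L, m L = 0
    · simp [sylowExcess, h0]
    · push Not at h0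
      obtain ⟨B, hB⟩ := h0
      obtain ⟨A, hA, -⟩ := exists_minimalMembers_le hB
      have hY := hm.multOne_minimalMembers
      obtain ⟨W, hWY, hW, hWp⟩ := exists_isSylowSpanning hK hY (multOne_ne_zero.2 hA)
      have h1 := hY.le_sylowExcess_multOne ih (isAntichain_minimalMembers m)
        (fun L hL => multOne_ne_zero.1 (hWY L hL)) hW hP
      have h2 := ihn _ (hn ▸ Finset.sum_lt_sum (fun L _ => Nat.sub_le _ _)
        ⟨A, Finset.mem_univ A, Nat.sub_lt
          (Nat.pos_of_ne_zero (mem_minimalMembers.1 hA).prop)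
          (Nat.pos_of_ne_zero (multOne_ne_zero.2 hA))⟩)
        (fun L => m L - multOne (minimalMembers m) L) hm.sub_multOne_minimalMembers rfl
      rw [sylowExcess_eq_add]
      have h3 : (W.card : ℤ) ≤ p := by exact_mod_cast hWp
      nlinarith [Int.natCast_nonneg p]

theorem sylowExcessBound_of_lt [Finite G] [Fact p.Prime] (hK : sylowCore p K = K)
    (ih : ∀ A < K, sylowCore p A = A → SylowExcessBound p A ∧ SylowExcessNonneg p A) :
    SylowExcessBound p K := by
  classical
  intro m hm W hWm hW P hP
  choose! f hfmem hfle using fun B (hB : m B ≠ 0) => exists_minimalMembers_le hB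
  have h1 := hm.multOne_minimalMembers.le_sylowExcess_multOne ih (isAntichain_minimalMembers m)
    (W := W.image f) (Finset.image_subset_iff.2 fun B hB => hfmem B (hWm B hB))
    (fun Q hQ => by
      obtain ⟨L, hL, hQL⟩ := hW Q hQ
      exact ⟨f L, Finset.mem_image_of_mem f hL, fun h => hQL (h.trans (hfle L (hWm L hL)))⟩) hP
  have h2 := sylowExcessNonneg_of_lt hK ih _ hm.sub_multOne_minimalMembers P hP
  have h3 : ((W.image f).card : ℤ) ≤ W.card := by exact_mod_cast Finset.card_image_le
  rw [sylowExcess_eq_add]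
  nlinarith [Int.natCast_nonneg p]

theorem sylowExcessBound_and_nonneg [Finite G] [Fact p.Prime] (K : Subgroup G)
    (hK : sylowCore p K = K) : SylowExcessBound p K ∧ SylowExcessNonneg p K := by
  induction K using WellFoundedLT.induction with
  | ind K ih => exact ⟨sylowExcessBound_of_lt hK ih, sylowExcessNonneg_of_lt hK ih⟩

end Minimal

end Family

open MulAction in
/-- An upper bound for the number of orbits of a `p`-group in terms of its fixed points. -/
theorem IsPGroup.mul_card_quotient_le {H Ω : Type*} [Group H] [Finite Ω] [MulAction H Ω] {p : ℕ}
    [Fact p.Prime] (hH : IsPGroup p H) :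
    p * Nat.card (orbitRel.Quotient H Ω) ≤
      Nat.card Ω + (p - 1) * Nat.card (fixedPoints H Ω) := by
  classical
  have hp : 0 < p := Nat.Prime.pos Fact.out
  have := Fintype.ofFinite Ω
  have := Fintype.ofFinite (orbitRel.Quotient H Ω)
  let π : Ω → orbitRel.Quotient H Ω := Quotient.mk''
  let F : Finset Ω := Finset.univ.filter (· ∈ fixedPoints H Ω)
  have hF : Nat.card (fixedPoints H Ω) = F.card := by
    rw [Nat.card_eq_fintype_card, Fintype.card_subtype]
  have h1 : Nat.card Ω = ∑ q, (Finset.univ.filter fun a => π a = q).card := by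
    rw [Nat.card_eq_fintype_card, ← Finset.card_univ]
    exact Finset.card_eq_sum_card_fiberwise fun _ _ => Finset.mem_univ _
  have h2 : F.card = ∑ q, (F.filter fun a => π a = q).card :=
    Finset.card_eq_sum_card_fiberwise fun _ _ => Finset.mem_univ _
  rw [hF, h1, h2, Finset.mul_sum, ← Finset.sum_add_distrib, Nat.card_eq_fintype_card, mul_comm,
    ← smul_eq_mul, ← Finset.card_univ]
  refine Finset.card_nsmul_le_sum _ _ _ fun q _ => ?_
  induction q using Quotient.inductionOn' with
  | h a =>
    have horb : Nat.card (orbit H a) = (Finset.univ.filter fun b => π b = π a).card := by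
      rw [Nat.card_eq_fintype_card, ← Set.toFinset_card]
      congr 1
      ext b
      simp only [Set.mem_toFinset, Finset.mem_filter, Finset.mem_univ, true_and, π]
      rw [Quotient.eq'', orbitRel_apply]
    by_cases ha : a ∈ fixedPoints H Ω
    · have h3 : 0 < (Finset.univ.filter fun b => π b = π a).card :=
        Finset.card_pos.2 ⟨a, by simp⟩
      have h4 : 0 < (F.filter fun b => π b = π a).card :=
        Finset.card_pos.2 ⟨a, by simpa [F] using ha⟩
      have h5 := Nat.le_mul_of_pos_right (p - 1) h4
      change p ≤ (Finset.univ.filter fun b => π b = π a).card +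
        (p - 1) * (F.filter fun b => π b = π a).card
      omega
    · exact (hH.le_card_orbit ha).trans (horb.le.trans (Nat.le_add_right _ _))

open MulAction in
/-- In a faithful transitive action of a finite group of order divisible by `p`, a Sylow
`p`-subgroup fixes at most `(p - 1) / p` times as many points as it moves. -/
theorem Sylow.mul_card_fixedPoints_le {G Ω : Type*} [Group G] [Finite G] [Finite Ω] [MulAction G Ω]
    [FaithfulSMul G Ω] [IsPretransitive G Ω] {p : ℕ} [Fact p.Prime] (hdvd : p ∣ Nat.card G)
    (P : Sylow p G) :
    (2 * p - 1 : ℤ) * Nat.card (fixedPoints P Ω) ≤ (p - 1) * Nat.card Ω := by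
  classical
  have := Fintype.ofFinite Ω
  have := Fintype.ofFinite (Subgroup G)
  let F : Finset Ω := Finset.univ.filter (· ∈ fixedPoints P Ω)
  have hF : Nat.card (fixedPoints P Ω) = F.card := by
    rw [Nat.card_eq_fintype_card, Fintype.card_subtype]
  have hmemF {a : Ω} : a ∈ F ↔ (P : Subgroup G) ≤ stabilizer G a := by
    simp only [F, Finset.mem_filter, Finset.mem_univ, true_and, mem_fixedPoints]
    exact ⟨fun h g hg => h ⟨g, hg⟩, fun h g => h g.2⟩
  rw [hF]
  rcases F.eq_empty_or_nonempty with h0 | ⟨a, ha⟩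
  · have : (1 : ℤ) ≤ p := by exact_mod_cast (Nat.Prime.one_le Fact.out)
    rw [h0, Finset.card_empty, Nat.cast_zero, mul_zero]
    exact mul_nonneg (by linarith) (Int.natCast_nonneg _)
  let K : Subgroup G := sylowCore p ⊤
  let r : Ω → Subgroup G := fun b => sylowCore p (stabilizer G b)
  let m : Subgroup G → ℕ := fun L => (Finset.univ.filter fun b => r b = L).card
  have hr (g : G) (b : Ω) : r (g • b) = MulAut.conj g • r b := by
    simp only [r]
    rw [conj_smul_sylowCore, stabilizer_smul_eq_stabilizer_map_conj]
    rfl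
  have hm0 {L : Subgroup G} (hL : m L ≠ 0) : ∃ b, r b = L := by
    obtain ⟨b, hb⟩ := Finset.card_ne_zero.1 hL
    exact ⟨b, (Finset.mem_filter.1 hb).2⟩
  have hm : IsSylowFamily p K m := by
    refine ⟨conj_invariant_of_le fun g hg L => ?_, fun L hL => ?_, fun L hL => ?_, fun L hL => ?_⟩
    · refine Finset.card_le_card_of_injOn (fun b => g • b) (fun b hb => ?_)
        fun b _ c _ h => smul_left_cancel _ h
      simp only [Finset.mem_coe, Finset.mem_filter, Finset.mem_univ, true_and] at hb ⊢
      rw [hr, hb]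
    · obtain ⟨b, rfl⟩ := hm0 hL
      have hle : r b ≤ K := sylowCore_le_iff.2 fun Q _ => Sylow.le_sylowCore_iff.2 le_top
      refine lt_of_le_of_ne hle fun h => ?_
      have hQ (Q : Sylow p G) : (Q : Subgroup G) ≤ stabilizer G b := by
        rw [← Sylow.le_sylowCore_iff]
        exact (Sylow.le_sylowCore_iff.2 le_top).trans h.symm.le
      have hP : (P : Subgroup G) = ⊥ := by
        refine (Subgroup.eq_bot_iff_forall _).2 fun x hx => ?_
        refine FaithfulSMul.eq_of_smul_eq_smul (α := Ω) fun c => ?_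
        obtain ⟨g, rfl⟩ := exists_smul_eq G b c
        have h1 := hQ (g⁻¹ • P)
        rw [Sylow.inv_smul_le_iff] at h1
        have h2 : x ∈ stabilizer G (g • b) := by
          rw [stabilizer_smul_eq_stabilizer_map_conj]
          exact h1 hx
        rw [one_smul]
        exact h2
      exact P.ne_bot_of_dvd_card hdvd hP
    · obtain ⟨b, rfl⟩ := hm0 hL
      exact sylowCore_sylowCore _
    · obtain ⟨b, rfl⟩ := hm0 hL
      obtain ⟨g, rfl⟩ := exists_smul_eq G a b
      refine ⟨g • P, Sylow.le_sylowCore_iff.2 ?_⟩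
      rw [Sylow.coe_subgroup_smul, stabilizer_smul_eq_stabilizer_map_conj]
      exact Subgroup.map_mono (hmemF.1 ha)
  have hpos := (sylowExcessBound_and_nonneg K (sylowCore_sylowCore ⊤)).2 m hm P
    (Sylow.le_sylowCore_iff.2 le_top)
  have hsum : sylowExcess P m = ∑ b, sylowWeight P (r b) := by
    rw [← Finset.sum_fiberwise Finset.univ r]
    refine Finset.sum_congr rfl fun L _ => ?_
    rw [Finset.sum_congr rfl fun b hb => by rw [(Finset.mem_filter.1 hb).2], Finset.sum_const,
      nsmul_eq_mul]
  have hsum' : ∑ b, sylowWeight P (r b) =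
      ∑ b, ((p - 1 : ℤ) + if b ∈ F then 1 - 2 * (p : ℤ) else 0) := by
    refine Finset.sum_congr rfl fun b _ => ?_
    unfold sylowWeight
    by_cases hb : b ∈ F
    · rw [if_pos hb, if_pos (Sylow.le_sylowCore_iff.2 (hmemF.1 hb))]
      ring
    · rw [if_neg hb, if_neg fun h => hb (hmemF.2 (Sylow.le_sylowCore_iff.1 h)), add_zero]
  rw [hsum, hsum', Finset.sum_add_distrib, Finset.sum_const, ← Finset.sum_filter,
    Finset.sum_const, Finset.filter_mem_eq_inter, Finset.univ_inter, nsmul_eq_mul, nsmul_eq_mul,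
    Finset.card_univ, ← Nat.card_eq_fintype_card] at hpos
  linarith

/-- if a finite group `G` acts faithfully and transitively on a finite
nonempty set `Ω`, `p` is an odd prime dividing `|G|` and `P` is a Sylow `p`-subgroup of
`G`, then the number of orbits of `P` on `Ω` is at most `(p/(2p-1)) ⬝ |Ω|`. -/
theorem stmt5 (G : Type) [Group G] [Finite G] (Ω : Type) [Fintype Ω] [Nonempty Ω]
    [MulAction G Ω] [FaithfulSMul G Ω] (htrans : MulAction.IsPretransitive G Ω)
    (p : ℕ) (hp : p.Prime) (hodd : Odd p) (hdvd : p ∣ Nat.card G)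
    (P : Sylow p G) :
    (Nat.card (MulAction.orbitRel.Quotient (P : Subgroup G) Ω) : ℚ) ≤
      ((p : ℚ) / (2 * (p : ℚ) - 1)) * (Nat.card Ω : ℚ) := by
  have := Fact.mk hp
  have hp2 : (2 : ℚ) ≤ p := by exact_mod_cast hp.two_le
  have h1 := P.isPGroup'.mul_card_quotient_le (Ω := Ω)
  have h2 := P.mul_card_fixedPoints_le (Ω := Ω) hdvd
  set k := Nat.card (MulAction.orbitRel.Quotient (P : Subgroup G) Ω)
  set f := Nat.card (MulAction.fixedPoints P Ω)
  set n := Nat.card Ω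
  have h1' : (p : ℚ) * k ≤ n + (p - 1) * f := by
    have : (p : ℚ) * k ≤ n + (p - 1 : ℕ) * f := by exact_mod_cast h1
    rwa [Nat.cast_sub hp.one_le, Nat.cast_one] at this
  have h2' : (2 * p - 1 : ℚ) * f ≤ (p - 1) * n := by exact_mod_cast h2
  rw [div_mul_eq_mul_div, le_div_iff₀ (by linarith)]
  have h3 : (2 * p - 1) * ((p : ℚ) * k) ≤ p * (p * n) :=
    calc (2 * p - 1) * ((p : ℚ) * k) ≤ (2 * p - 1) * (n + (p - 1) * f) :=
          mul_le_mul_of_nonneg_left h1' (by linarith)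
      _ = (2 * p - 1) * n + (p - 1) * ((2 * p - 1) * f) := by ring
      _ ≤ (2 * p - 1) * n + (p - 1) * ((p - 1) * n) := by
          gcongr
          linarith
      _ = p * (p * n) := by ring
  refine le_of_mul_le_mul_left ?_ (by linarith : (0 : ℚ) < p)
  linarith
end

section
/- Let p be a prime. For every real ε > 0 there exists N such that for every natural number n > N with p ≤ n, there exists a p-element x in the alternating group A_n with the property that for every faithful primitive action of A_n on a finite nonempty set Ω, fpr(x,Ω) ≤ ε. -/
/-- A group action is primitive if it is transitive and every block is trivial. -/
def IsPrimitiveAction (G Ω : Type) [Group G] [MulAction G Ω] : Prop :=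
  MulAction.IsPretransitive G Ω ∧
    ∀ B : Set Ω, MulAction.IsBlock G B → MulAction.IsTrivialBlock B

open Equiv MulAction Filter Topology
open scoped Pointwise

universe u

theorem card_mul_card_le_factorial {α I : Type*} [Finite α] [Finite I]
    (K : Subgroup (Perm α)) (σ : I → Perm α)
    (h : ∀ i j, ∀ k ∈ K, σ i * k = σ j → i = j) :
    Nat.card I * Nat.card K ≤ (Nat.card α).factorial := by
  rw [← Nat.card_perm, ← Nat.card_prod]
  refine Nat.card_le_card_of_injective (fun y : I × K ↦ σ y.1 * y.2) ?_
  rintro ⟨i, k⟩ ⟨j, l⟩ hkl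
  simp only at hkl
  obtain rfl : i = j := h i j (k * l⁻¹) (k * l⁻¹).2 (by simp [← mul_assoc, hkl])
  simpa using hkl

theorem isThreeCycle_commutator {α : Type*} [Fintype α] [DecidableEq α] {g h : Perm α} {a : α}
    (ha : h a ≠ a) (ga : g a ≠ a) (hgh : ∀ b, b ≠ a → h b = b ∨ g b = b) :
    (g * h * g⁻¹ * h⁻¹).IsThreeCycle := by
  have hfix : ∀ (k : Perm α) (b : α), k b = b → k⁻¹ b = b := fun k b hb ↦ by
    rw [Perm.inv_eq_iff_eq, hb]
  have hr : ∀ (k : Perm α) (b : α), k (k⁻¹ b) = b := fun k b ↦ by simp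
  have hl : ∀ (k : Perm α) (b : α), k⁻¹ (k b) = b := fun k b ↦ by simp
  have hga : h (g a) = g a := (hgh _ ga).resolve_right fun e ↦ ga (g.injective e)
  have gha : g (h a) = h a := (hgh _ ha).resolve_left fun e ↦ ha (h.injective e)
  have hg' : h a ≠ g a := fun e ↦ ha (h.injective (by rw [e, hga]))
  have key : g * h * g⁻¹ * h⁻¹ = swap a (h a) * swap a (g a) := by
    ext y
    simp only [Perm.mul_apply]
    by_cases hy : y = a
    · subst hy
      have h1 : h⁻¹ y ≠ y := fun e ↦ ha (by rw [Perm.inv_eq_iff_eq] at e; exact e.symm)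
      have h2 : g (h⁻¹ y) = h⁻¹ y := (hgh _ h1).resolve_left fun e ↦ h1 (by simpa using e.symm)
      rw [hfix g _ h2, hr, swap_apply_left,
        swap_apply_of_ne_of_ne ga hg'.symm]
    by_cases hy1 : y = g a
    · subst hy1
      rw [hfix h _ hga, hl, gha, swap_apply_right, swap_apply_left]
    by_cases hy2 : y = h a
    · subst hy2
      rw [hl, swap_apply_of_ne_of_ne ha hg', swap_apply_right]
      rcases eq_or_ne (g⁻¹ a) a with e | e
      · rw [Perm.inv_eq_iff_eq] at e
        exact absurd e.symm ga
      · rw [(hgh _ e).resolve_right fun e' ↦ e (by simpa using e'.symm), hr]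
    · rw [swap_apply_of_ne_of_ne hy hy1, swap_apply_of_ne_of_ne hy hy2]
      rcases hgh y hy with e | e
      · have h1 : g⁻¹ y ≠ a := fun e' ↦ hy1 (by rw [← e', hr])
        rw [hfix h _ e]
        rcases hgh _ h1 with e' | e'
        · rw [e', hr]
        · have e'' : g⁻¹ y = y := by simpa using e'.symm
          rw [e'', e, ← e'', hr, e'']
      · have h1 : h⁻¹ y ≠ a := fun e' ↦ hy2 (by rw [← e', hr])
        rcases hgh _ h1 with e' | e'
        · have e'' : h⁻¹ y = y := by simpa using e'.symm
          have e3 : h y = y := by rw [e''] at e'; exact e'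
          rw [e'', hfix g _ e, e3, e]
        · rw [hfix g _ e', hr, e]
  rw [key]
  exact Perm.isThreeCycle_swap_mul_swap_same ha.symm ga.symm hg'

theorem exists_base {α : Type*} [Fintype α] [DecidableEq α] {K : Subgroup (Perm α)}
    (hK : IsPreprimitive K α) (hA : ¬ alternatingGroup α ≤ K) :
    ∃ s : Finset α, 2 * s.card ≤ Fintype.card α ∧ ∀ g ∈ K, (∀ a ∈ s, g a = a) → g = 1 := by
  classical
  let P : Finset α → Prop := fun s ↦ ∀ g ∈ K, (∀ a ∈ s, g a = a) → g = 1
  obtain ⟨s, hs, hmin⟩ := Finset.exists_min_image (Finset.univ.filter P) Finset.card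
    ⟨Finset.univ, Finset.mem_filter.2 ⟨Finset.mem_univ _, fun g _ hg ↦ Perm.ext fun a ↦ hg a (Finset.mem_univ a)⟩⟩
  have hs : P s := by simpa using hs
  have hmin : ∀ t : Finset α, t.card < s.card → ¬ P t := fun t ht hP ↦
    absurd (hmin t (by simpa using hP)) (by omega)
  refine ⟨s, ?_, hs⟩
  by_contra! hcard
  obtain ⟨h, hK', hfix, h1⟩ : ∃ h ∈ K, (∀ a ∈ sᶜ, h a = a) ∧ h ≠ 1 := by
    have := hmin sᶜ (by rw [Finset.card_compl]; omega)
    simpa only [P, not_forall, exists_prop] using this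
  obtain ⟨a, ha⟩ : ∃ a, h a ≠ a := by
    by_contra! H
    exact h1 (Perm.ext H)
  have has : a ∈ s := by
    by_contra H
    exact ha (hfix a (by simpa using H))
  obtain ⟨g, gK, gfix, g1⟩ : ∃ g ∈ K, (∀ b ∈ s.erase a, g b = b) ∧ g ≠ 1 := by
    have := hmin (s.erase a) (Finset.card_erase_lt_of_mem has)
    simpa only [P, not_forall, exists_prop] using this
  have ga : g a ≠ a := by
    intro H
    refine g1 (hs g gK fun b hb ↦ ?_)
    rcases eq_or_ne b a with rfl | hba
    · exact H
    · exact gfix b (Finset.mem_erase.2 ⟨hba, hb⟩)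
  refine hA (Perm.alternatingGroup_le_of_isPreprimitive_of_isThreeCycle_mem hK
    (isThreeCycle_commutator ha ga fun b hb ↦ ?_)
    (mul_mem (mul_mem (mul_mem gK hK') (inv_mem gK)) (inv_mem hK')))
  by_cases hbs : b ∈ s
  · exact .inr (gfix b (Finset.mem_erase.2 ⟨hb, hbs⟩))
  · exact .inl (hfix b (by simpa using hbs))

theorem two_pow_pred_le_factorial (n : ℕ) : 2 ^ (n - 1) ≤ n.factorial := by
  cases n with
  | zero => simp
  | succ n => simpa [add_comm] using Nat.factorial_mul_pow_le_factorial (m := 1) (n := n)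

theorem factorial_mul_card_le_of_primitive {α : Type*} [Fintype α] [DecidableEq α]
    {K : Subgroup (Perm α)} (hK : IsPreprimitive K α) (hA : ¬ alternatingGroup α ≤ K) :
    ∃ k, Fintype.card α ≤ 2 * k ∧
      k.factorial * Nat.card K ≤ (Fintype.card α).factorial := by
  obtain ⟨s, hs, hbase⟩ := exists_base hK hA
  have hc := Finset.card_compl s
  have hle := s.card_le_univ
  refine ⟨sᶜ.card, by omega, ?_⟩
  have := card_mul_card_le_factorial K
    (Perm.ofSubtype : Perm {a // a ∈ sᶜ} →* Perm α) fun i j k hk hijk ↦ ?_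
  · rwa [Nat.card_perm, Nat.card_eq_fintype_card (α := α), Nat.card_eq_fintype_card,
      Fintype.card_coe] at this
  · have : k = Perm.ofSubtype (i⁻¹ * j) := by
      rw [map_mul, map_inv, ← hijk]; group
    have hk1 : k = 1 := hbase k hk fun a ha ↦ by
      rw [this, Perm.ofSubtype_apply_of_not_mem]
      simpa using ha
    rw [hk1, mul_one] at hijk
    exact Perm.ofSubtype_injective hijk

theorem factorial_pow_mul_card_le {α Q M : Type*} [Fintype α] [Fintype Q] [Fintype M]
    (K : Subgroup (Perm α)) (e : α ≃ Q × Option M)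
    (hK : ∀ k ∈ K, ∀ a b, (e a).1 = (e b).1 → (e (k a)).1 = (e (k b)).1) :
    (Fintype.card Q).factorial ^ Fintype.card M * Nat.card K ≤ (Fintype.card α).factorial := by
  classical
  let τ : (M → Perm Q) → Option M → Perm Q := fun f i ↦ i.elim 1 f
  let ρ : (M → Perm Q) → Perm (Q × Option M) := fun f ↦
    { toFun := fun y ↦ (τ f y.2 y.1, y.2)
      invFun := fun y ↦ ((τ f y.2)⁻¹ y.1, y.2)
      left_inv := fun y ↦ by simp
      right_inv := fun y ↦ by simp }
  have := card_mul_card_le_factorial K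
    (fun f : M → Perm Q ↦ e.symm.permCongr (ρ f)) fun f g k hk hfg ↦ ?_
  · simpa [Nat.card_perm, Fintype.card_perm] using this
  · have hfg' : ∀ y, ρ f (e (k (e.symm y))) = ρ g y := fun y ↦ by
      have := congrArg e (Perm.congr_fun hfg (e.symm y))
      simpa [Equiv.permCongr_apply] using this
    ext i q
    have h0 : (e (k (e.symm (q, none)))).1 = q := by
      have := hfg' (q, none)
      simp only [ρ, τ, Equiv.coe_fn_mk, Prod.ext_iff] at this
      obtain ⟨h1, h2⟩ := this
      rw [h2] at h1
      exact h1
    have h1 : (e (k (e.symm (q, some i)))).1 = q := by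
      refine Eq.trans ?_ h0
      exact hK k hk _ _ (by simp)
    have := hfg' (q, some i)
    simp only [ρ, τ, Equiv.coe_fn_mk, Prod.ext_iff] at this
    obtain ⟨h2, h3⟩ := this
    rw [h3, h1] at h2
    simpa using h2

theorem exists_equiv_prod_of_isBlock {α : Type u} [Fintype α] {K : Subgroup (Perm α)}
    [IsPretransitive K α] {B : Set α} (hB : IsBlock K B) (hne : B.Nonempty) :
    ∃ (Q : Type u) (_ : Fintype Q) (e : α ≃ Q × B),
      ∀ k ∈ K, ∀ a b, (e a).1 = (e b).1 → (e (k a)).1 = (e (k b)).1 := by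
  classical
  obtain ⟨b₀, hb₀⟩ := hne
  have hex : ∀ a : α, ∃ k : K, k • b₀ = a := fun a ↦ exists_smul_eq K b₀ a
  choose κ hκ using hex
  let π : α → Set α := fun a ↦ κ a • B
  have hmem : ∀ a, a ∈ π a := fun a ↦ ⟨b₀, hb₀, hκ a⟩
  have heq : ∀ (k : K) a, a ∈ k • B → π a = k • B := fun k a ha ↦
    isBlock_iff_smul_eq_smul_of_nonempty.1 hB ⟨a, hmem a, ha⟩
  have hfib : ∀ a b, π b = π a ↔ b ∈ π a := fun a b ↦
    ⟨fun h ↦ h ▸ hmem b, fun h ↦ heq _ _ h⟩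
  have hsmul : ∀ (k : K) a, π (k • a) = k • π a := fun k a ↦ by
    rw [show k • π a = (k * κ a) • B from (mul_smul _ _ _).symm]
    exact heq _ _ (by rw [mul_smul]; exact Set.smul_mem_smul_set (hmem a))
  let ρ : α → Set.range π := fun a ↦ ⟨π a, a, rfl⟩
  have hcard : ∀ q : Set.range π, Nonempty ({a // ρ a = q} ≃ B) := by
    rintro ⟨_, a, rfl⟩
    refine ⟨(Equiv.subtypeEquivRight fun b ↦ ?_).trans ((MulAction.toPerm (κ a)).image B).symm⟩
    exact Subtype.ext_iff.trans (hfib a b)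
  let e : α ≃ Set.range π × B := (Equiv.sigmaFiberEquiv ρ).symm.trans
    ((Equiv.sigmaCongrRight fun q ↦ (hcard q).some).trans (Equiv.sigmaEquivProd _ _))
  have he : ∀ a, (e a).1 = ρ a := fun a ↦ rfl
  refine ⟨Set.range π, Fintype.ofFinite _, e, fun k hk a b hab ↦ ?_⟩
  have hab' : π a = π b := congrArg Subtype.val hab
  have h1 := hsmul ⟨k, hk⟩ a
  rw [hab', ← hsmul] at h1
  exact Subtype.ext h1

theorem two_pow_mul_card_le_of_isBlock {α : Type*} [Fintype α] {K : Subgroup (Perm α)}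
    [IsPretransitive K α] {B : Set α} (hB : IsBlock K B) (hB' : ¬ IsTrivialBlock B) :
    ∃ j, Fintype.card α ≤ 4 * j ∧ 2 ^ j * Nat.card K ≤ (Fintype.card α).factorial := by
  classical
  obtain ⟨h1, h2⟩ := not_or.1 hB'
  rw [Set.not_subsingleton_iff] at h1
  obtain ⟨Q, _, e, he⟩ := exists_equiv_prod_of_isBlock hB h1.nonempty
  obtain ⟨b₀, hb₀⟩ := h1.nonempty
  let e' : α ≃ Q × Option {b : B // b ≠ ⟨b₀, hb₀⟩} :=
    e.trans (Equiv.prodCongr (Equiv.refl Q) (Equiv.optionSubtypeNe (⟨b₀, hb₀⟩ : B)).symm)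
  have key := factorial_pow_mul_card_le K e' fun k hk a b ↦ by simpa [e'] using he k hk a b
  have hc : Fintype.card α = Fintype.card Q * Fintype.card B := by
    rw [← Fintype.card_prod]; exact Fintype.card_congr e
  have hM : Fintype.card {b : B // b ≠ ⟨b₀, hb₀⟩} = Fintype.card B - 1 := by simp
  have hB2 : 2 ≤ Fintype.card B := by
    have := Set.nontrivial_coe_sort.2 h1
    exact Fintype.one_lt_card
  have hQ2 : 2 ≤ Fintype.card Q := by
    by_contra! H
    apply h2
    have hle : Fintype.card α ≤ Fintype.card B := by rw [hc]; nlinarith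
    exact Set.eq_of_subset_of_card_le (Set.subset_univ B) (by simpa using hle)
  refine ⟨(Fintype.card Q - 1) * (Fintype.card B - 1), ?_, ?_⟩
  · obtain ⟨q, hq⟩ := Nat.exists_eq_add_of_le hQ2
    obtain ⟨m, hm⟩ := Nat.exists_eq_add_of_le hB2
    rw [hc, hq, hm, show 2 + q - 1 = q + 1 by omega, show 2 + m - 1 = m + 1 by omega]
    nlinarith
  · rw [hM] at key
    rw [pow_mul]
    exact (Nat.mul_le_mul_right _ (Nat.pow_le_pow_left (two_pow_pred_le_factorial _) _)).trans key

theorem two_pow_mul_card_le_of_isPretransitive {α : Type*} [Fintype α] [DecidableEq α]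
    {K : Subgroup (Perm α)} [IsPretransitive K α] (hA : ¬ alternatingGroup α ≤ K)
    (hα : 4 ≤ Fintype.card α) :
    ∃ j, Fintype.card α ≤ 4 * j ∧ 2 ^ j * Nat.card K ≤ (Fintype.card α).factorial := by
  by_cases hK : IsPreprimitive K α
  · obtain ⟨k, hk, h⟩ := factorial_mul_card_le_of_primitive hK hA
    exact ⟨k - 1, by omega,
      (Nat.mul_le_mul_right _ (two_pow_pred_le_factorial k)).trans h⟩
  · obtain ⟨B, hB, hB'⟩ : ∃ B : Set α, IsBlock K B ∧ ¬ IsTrivialBlock B := by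
      by_contra! H
      exact hK { isTrivialBlock_of_isBlock := fun {B} hB ↦ H B hB }
    exact two_pow_mul_card_le_of_isBlock hB hB'

theorem card_fixedBy_le_card_centralizer {G Ω : Type*} [Group G] [Finite G] [MulAction G Ω]
    [IsPretransitive G Ω] [Finite Ω] [Nonempty Ω] (x : G) :
    Nat.card (fixedBy Ω x) ≤ Nat.card (Subgroup.centralizer {x}) := by
  classical
  obtain ⟨ω⟩ := ‹Nonempty Ω›
  choose γ hγ using exists_smul_eq G ω
  let H := stabilizer G ω
  let P := {g : G // g⁻¹ * x * g ∈ H}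
  have h1 : Nat.card (fixedBy Ω x) * Nat.card H ≤ Nat.card P := by
    rw [← Nat.card_prod]
    refine Nat.card_le_card_of_injective (fun y ↦ ⟨γ y.1 * y.2, ?_⟩) ?_
    · have hy : x • y.1.1 = y.1.1 := y.1.2
      have h2 : y.2.1 • ω = ω := y.2.2
      have h3 : γ y.1 • ω = y.1 := hγ _
      rw [mem_stabilizer_iff, mul_smul, mul_smul, mul_smul, h2, h3, hy, inv_smul_eq_iff,
        mul_smul, h2, h3]
    · rintro ⟨a, h⟩ ⟨b, k⟩ hab
      have hab : γ a * h = γ b * k := congrArg Subtype.val hab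
      have e : a = b := by
        have h2 : h.1 • ω = ω := h.2
        have h3 : k.1 • ω = ω := k.2
        have := congrArg (· • ω) hab
        simp only [mul_smul, h2, h3, hγ] at this
        exact Subtype.ext this
      subst e
      simpa using hab
  have h2 : Nat.card P ≤ Nat.card H * Nat.card (Subgroup.centralizer {x}) := by
    rw [← Nat.card_prod]
    let δ : H → G := fun h ↦ if H : ∃ g, g⁻¹ * x * g = h then H.choose else 1
    have hδ : ∀ g : P, (δ ⟨_, g.2⟩)⁻¹ * x * δ ⟨_, g.2⟩ = g.1⁻¹ * x * g.1 := fun g ↦ by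
      have : ∃ g' : G, g'⁻¹ * x * g' = g.1⁻¹ * x * g.1 := ⟨g.1, rfl⟩
      simp only [δ, dif_pos this]
      exact this.choose_spec
    refine Nat.card_le_card_of_injective
      (fun g ↦ (⟨_, g.2⟩, ⟨g.1 * (δ ⟨_, g.2⟩)⁻¹, ?_⟩)) ?_
    · rw [Subgroup.mem_centralizer_singleton_iff]
      have := hδ g
      generalize δ ⟨_, g.2⟩ = d at this ⊢
      have e : x * d = d * (g.1⁻¹ * x * g.1) := by rw [← this]; group
      have e' : d⁻¹ * x = (g.1⁻¹ * x * g.1) * d⁻¹ := by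
        rw [← this]; group
      rw [mul_assoc, e']
      group
    · intro g g' h
      simp only [Prod.mk.injEq, Subtype.mk.injEq] at h
      obtain ⟨ha, hb⟩ := h
      simp only [ha, mul_left_inj] at hb
      exact Subtype.ext hb
  have hpos : 0 < Nat.card H := Nat.card_pos
  nlinarith

theorem card_fixedBy_le_of_stabilizer_eq {G Ω Ω' : Type*} [Group G] [MulAction G Ω]
    [MulAction G Ω'] [IsPretransitive G Ω] [Finite Ω'] {ω : Ω} {ω' : Ω'}
    (h : stabilizer G ω = stabilizer G ω') (x : G) :
    Nat.card (fixedBy Ω x) ≤ Nat.card (fixedBy Ω' x) := by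
  choose γ hγ using exists_smul_eq G ω
  have key : ∀ g : G, g • ω = ω ↔ g • ω' = ω' := fun g ↦ by
    rw [← mem_stabilizer_iff, h, mem_stabilizer_iff]
  refine Nat.card_le_card_of_injective (fun a ↦ ⟨γ a • ω', ?_⟩) fun a b hab ↦ ?_
  · have ha : x • a.1 = a.1 := a.2
    have := (key ((γ a)⁻¹ * (x * γ a))).1 (by
      rw [mul_smul, mul_smul, hγ, ha, inv_smul_eq_iff, hγ])
    rwa [mul_smul, mul_smul, inv_smul_eq_iff] at this
  · have hab : γ a • ω' = γ b • ω' := congrArg Subtype.val hab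
    have := (key ((γ a)⁻¹ * γ b)).2 (by rw [mul_smul, ← hab, inv_smul_smul])
    rw [mul_smul, hγ, inv_smul_eq_iff, hγ] at this
    exact Subtype.ext this.symm

theorem card_centralizer_le {α : Type*} [Fintype α] [DecidableEq α] (x : alternatingGroup α)
    (R : Finset α) (hR : ∀ y, ∃ r ∈ R, ∃ i : ℕ, (x ^ i) • r = y) :
    Nat.card (Subgroup.centralizer {x}) ≤ Fintype.card α ^ R.card := by
  have : Nat.card (R → α) = Fintype.card α ^ R.card := by simp
  rw [← this]
  refine Nat.card_le_card_of_injective (fun g r ↦ g.1 • r.1) fun g h hgh ↦ ?_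
  refine Subtype.ext (Subtype.ext (Perm.ext fun y ↦ ?_))
  obtain ⟨r, hr, i, rfl⟩ := hR y
  have hc : ∀ g : Subgroup.centralizer {x}, g.1 • x ^ i • r = x ^ i • g.1 • r := fun g ↦ by
    have : Commute g.1 x := Subgroup.mem_centralizer_singleton_iff.1 g.2
    rw [← mul_smul, (this.pow_right i).eq, mul_smul]
  have h1 : g.1 • r = h.1 • r := congrFun hgh ⟨r, hr⟩
  change g.1 • x ^ i • r = h.1 • x ^ i • r
  rw [hc, hc, h1]

theorem card_fixedBy_powersetCard_le_two_pow {α : Type*} [Fintype α] [DecidableEq α]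
    (x : alternatingGroup α) (R : Finset α) (hR : ∀ y, ∃ r ∈ R, ∃ i : ℕ, (x ^ i) • r = y)
    (k : ℕ) : Nat.card (fixedBy (Set.powersetCard α k) x) ≤ 2 ^ R.card := by
  have : Nat.card (R → Prop) = 2 ^ R.card := by simp
  rw [← this]
  refine Nat.card_le_card_of_injective (fun s r ↦ r.1 ∈ (s.1 : Finset α)) fun s t hst ↦ ?_
  refine Subtype.ext (Subtype.ext (Finset.ext fun y ↦ ?_))
  obtain ⟨r, hr, i, rfl⟩ := hR y
  have hc : ∀ s : fixedBy (Set.powersetCard α k) x,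
      x ^ i • r ∈ (s.1 : Finset α) ↔ r ∈ (s.1 : Finset α) := fun s ↦ by
    have h1 : x ^ i • s.1 = s.1 := by
      have : x ∈ stabilizer (alternatingGroup α) s.1 := s.2
      exact pow_mem this i
    have h2 : x ^ i • (s.1 : Finset α) = s.1 := congrArg Subtype.val h1
    nth_rw 1 [← h2]
    rw [Finset.smul_mem_smul_finset_iff]
  have h1 : (r ∈ (s.1 : Finset α)) = (r ∈ (t.1 : Finset α)) := congrFun hst ⟨r, hr⟩
  rw [hc, hc, h1]

theorem card_fixedBy_powersetCard_le_choose {α : Type*} [Fintype α] [DecidableEq α]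
    (x : alternatingGroup α) (F : Finset α) (k : ℕ)
    (hF : ∀ s : Finset α, x • s = s → s.card = k → s ⊆ F) :
    Nat.card (fixedBy (Set.powersetCard α k) x) ≤ F.card.choose k := by
  rw [← Finset.card_powersetCard, ← Fintype.card_coe, ← Nat.card_eq_fintype_card]
  refine Nat.card_le_card_of_injective
    (fun s ↦ (⟨s.1.1, ?_⟩ : {t // t ∈ F.powersetCard k})) fun s t hst ↦ ?_
  · exact Finset.mem_powersetCard.2 ⟨hF _ (congrArg Subtype.val s.2) s.1.2, s.1.2⟩
  · have h := Subtype.ext_iff.1 hst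
    exact Subtype.ext (Subtype.ext h)

theorem primitive_action_cases {α : Type*} [Fintype α] [DecidableEq α]
    (hα : 4 ≤ Fintype.card α) {Ω : Type*} [Finite Ω] [Nontrivial Ω]
    [MulAction (alternatingGroup α) Ω] [IsPreprimitive (alternatingGroup α) Ω] :
    (∃ k, 1 ≤ k ∧ 2 * k ≤ Fintype.card α ∧ Nat.card Ω = (Fintype.card α).choose k ∧
      ∀ x : alternatingGroup α,
        Nat.card (fixedBy Ω x) ≤ Nat.card (fixedBy (Set.powersetCard α k) x)) ∨
    ∃ j, Fintype.card α ≤ 4 * j ∧ 2 ^ j ≤ 2 * Nat.card Ω := by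
  classical
  obtain ⟨ω⟩ := (inferInstance : Nonempty Ω)
  have hco : IsCoatom (stabilizer (alternatingGroup α) ω) := 
    IsPreprimitive.isCoatom_stabilizer_of_isPreprimitive _ ω
  have hαn : Nontrivial α := Fintype.one_lt_card_iff_nontrivial.1 (by omega)
  set H := stabilizer (alternatingGroup α) ω with hH
  by_cases ht : IsPretransitive (H.map (alternatingGroup α).subtype) α
  · right
    have hA : ¬ alternatingGroup α ≤ H.map (alternatingGroup α).subtype := by
      intro h
      refine hco.1 (eq_top_iff.2 fun g _ ↦ ?_)
      obtain ⟨g', hg', e⟩ := h g.2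
      rwa [← Subtype.ext e]
    obtain ⟨j, hj, h⟩ := two_pow_mul_card_le_of_isPretransitive hA hα
    refine ⟨j, hj, ?_⟩
    have h1 : Nat.card (H.map (alternatingGroup α).subtype) = Nat.card H :=
      Nat.card_congr (H.equivMapOfInjective _ Subtype.val_injective).symm.toEquiv
    have h2 : Nat.card H * Nat.card Ω = Nat.card (alternatingGroup α) := by
      rw [← index_stabilizer_of_transitive (alternatingGroup α) ω]
      exact H.card_mul_index
    have h3 : 2 * Nat.card (alternatingGroup α) = (Fintype.card α).factorial := by
      rw [two_mul_nat_card_alternatingGroup, Nat.card_perm, Nat.card_eq_fintype_card]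
    rw [h1, ← h3, ← h2] at h
    have hpos : 0 < Nat.card H := Nat.card_pos
    exact Nat.le_of_mul_le_mul_right (by linarith) hpos
  · left
    obtain ⟨s, hs0, hs1, hs⟩ : ∃ s : Finset α, s.Nonempty ∧ sᶜ.Nonempty ∧
        H ≤ stabilizer (alternatingGroup α) s := by
      obtain ⟨a, b, hab⟩ : ∃ a b : α, ∀ g ∈ H, g • a ≠ b := by
        by_contra! hh
        refine ht ⟨fun a b ↦ ?_⟩
        obtain ⟨g, hg, e⟩ := hh a b
        exact ⟨⟨g.1, g, hg, rfl⟩, e⟩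
      refine ⟨Finset.univ.filter fun b ↦ ∃ g ∈ H, g • a = b, 
        ⟨a, Finset.mem_filter.2 ⟨Finset.mem_univ _, 1, H.one_mem, one_smul _ _⟩⟩,
        ⟨b, by
          rw [Finset.mem_compl, Finset.mem_filter]
          rintro ⟨-, g, hg, e⟩
          exact hab g hg e⟩, fun g hg ↦ ?_⟩
      rw [mem_stabilizer_iff]
      refine Finset.eq_of_subset_of_card_le (fun c hc ↦ ?_) (by simp)
      obtain ⟨d, hd, rfl⟩ := Finset.mem_smul_finset.1 hc
      obtain ⟨g', hg', rfl⟩ := (Finset.mem_filter.1 hd).2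
      exact Finset.mem_filter.2 ⟨Finset.mem_univ _, g * g', H.mul_mem hg hg', mul_smul _ _ _⟩
    wlog hsc : 2 * s.card ≤ Fintype.card α generalizing s
    · refine this sᶜ hs1 (by simpa using hs0) (fun g hg ↦ ?_) ?_
      · have := mem_stabilizer_iff.1 (hs hg)
        rw [mem_stabilizer_iff, ← Finset.coe_inj] at *
        push_cast at *
        rw [Set.smul_set_compl, this]
      · rw [Finset.card_compl]; omega
    let s' : Set.powersetCard α s.card := ⟨s, rfl⟩
    have htr : IsPretransitive (alternatingGroup α) (Set.powersetCard α s.card) :=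
      Set.powersetCard.isPretransitive_alternatingGroup (by rw [Nat.card_eq_fintype_card]; omega)
    have hs' : H ≤ stabilizer (alternatingGroup α) s' := fun g hg ↦ Subtype.ext (hs hg)
    have hne : stabilizer (alternatingGroup α) s' ≠ ⊤ := by
      intro htop
      have : Nontrivial (Set.powersetCard α s.card) := Set.powersetCard.nontrivial' hs0.card_pos
        (by rw [Nat.card_eq_fintype_card]; omega)
      obtain ⟨t, ht⟩ := exists_ne s'
      obtain ⟨g, hg⟩ := exists_smul_eq (alternatingGroup α) s' t
      have : g ∈ stabilizer (alternatingGroup α) s' := htop ▸ Subgroup.mem_top g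
      exact ht (hg.symm.trans this)
    have heq : H = stabilizer (alternatingGroup α) s' :=
      (hco.le_iff.1 hs').resolve_left hne |>.symm
    refine ⟨s.card, hs0.card_pos, hsc, ?_, fun x ↦ card_fixedBy_le_of_stabilizer_eq heq x⟩
    rw [← index_stabilizer_of_transitive (alternatingGroup α) ω, ← hH, heq,
      index_stabilizer_of_transitive, Set.powersetCard.card, Nat.card_eq_fintype_card]

theorem exists_even_perm_of_cycles {α : Type*} [Fintype α] [DecidableEq α] {q a b : ℕ}
    (hq : 0 < q) (hα : Fintype.card α = q * (2 * a) + b) :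
    ∃ (x : alternatingGroup α) (R F : Finset α), x ^ q = 1 ∧ R.card ≤ 2 * a + b ∧ F.card ≤ b ∧
      (∀ y, ∃ r ∈ R, ∃ i : ℕ, (x ^ i) • r = y) ∧
      ∀ s : Finset α, x • s = s → s.card < q → s ⊆ F := by
  classical
  have : NeZero q := ⟨hq.ne'⟩
  let β := (ZMod q × Fin (2 * a)) ⊕ Fin b
  have e : β ≃ α := Fintype.equivOfCardEq (by simp [β, ZMod.card, hα])
  let c : Perm (ZMod q × Fin (2 * a)) := Equiv.prodCongrLeft fun _ ↦ Equiv.addRight 1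
  let x : Perm α := e.permCongr (Perm.sumCongr c 1)
  have hsign : Perm.sign x = 1 := by
    have h1 : Perm.sign c = 1 := by
      rw [Perm.sign_prodCongrLeft, Finset.prod_const, Finset.card_univ, Fintype.card_fin, pow_mul,
        Int.units_sq, one_pow]
    rw [Perm.sign_permCongr, Perm.sign_sumCongr, h1, map_one, one_mul]
  have hx : ∀ y, x (e y) = e (Perm.sumCongr c 1 y) := fun y ↦ by
    simp only [x, Equiv.permCongr_apply, Equiv.symm_apply_apply]
  have hx1 : ∀ (i : ℕ) z j, (x ^ i) (e (.inl (z, j))) = e (.inl (z + i, j)) := by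
    intro i
    induction i with
    | zero => simp
    | succ i ih =>
      intro z j
      rw [pow_succ', Perm.mul_apply, ih, hx, Nat.cast_add_one, ← add_assoc]
      rfl
  have hx2 : ∀ (i : ℕ) j, (x ^ i) (e (.inr j)) = e (.inr j) := by
    intro i
    induction i with
    | zero => simp
    | succ i ih =>
      intro j
      rw [pow_succ', Perm.mul_apply, ih, hx]
      rfl
  have hcoe : ∀ (i : ℕ) y, ((⟨x, hsign⟩ : alternatingGroup α) ^ i) • y = (x ^ i) y :=
    fun i y ↦ rfl
  refine ⟨⟨x, hsign⟩,
    Finset.univ.image (fun j : Fin (2 * a) ⊕ Fin b ↦ e (j.map (fun j ↦ (0, j)) id)),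
    Finset.univ.image (fun j : Fin b ↦ e (.inr j)), ?_, ?_, ?_, ?_, ?_⟩
  · refine Subtype.ext (Perm.ext fun y ↦ ?_)
    obtain ⟨y, rfl⟩ := e.surjective y
    rcases y with ⟨z, j⟩ | j
    · simpa using hx1 q z j
    · exact hx2 q j
  · exact Finset.card_image_le.trans (by simp)
  · exact Finset.card_image_le.trans (by simp)
  · intro y
    obtain ⟨y, rfl⟩ := e.surjective y
    rcases y with ⟨z, j⟩ | j
    · refine ⟨_, Finset.mem_image_of_mem _ (Finset.mem_univ (.inl j)), z.val, ?_⟩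
      rw [hcoe]
      simp [hx1]
    · exact ⟨_, Finset.mem_image_of_mem _ (Finset.mem_univ (.inr j)), 0, by simp⟩
  · intro s hs hcard y hy
    have hinv : ∀ i : ℕ, ∀ y ∈ s, (x ^ i) y ∈ s := by
      intro i y hy
      have h1 : (⟨x, hsign⟩ : alternatingGroup α) ^ i ∈ stabilizer (alternatingGroup α) s :=
        pow_mem (mem_stabilizer_iff.2 hs) i
      rw [← hcoe, ← mem_stabilizer_iff.1 h1]
      exact Finset.smul_mem_smul_finset hy
    obtain ⟨y, rfl⟩ := e.surjective y
    rcases y with ⟨z, j⟩ | j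
    · refine absurd hcard (not_lt.2 ?_)
      have : (Finset.univ.image fun w : ZMod q ↦ e (.inl (w, j))) ⊆ s := by
        intro y hy'
        obtain ⟨w, -, rfl⟩ := Finset.mem_image.1 hy'
        have := hinv (w - z).val _ hy
        rw [hx1] at this
        simpa using this
      refine le_trans ?_ (Finset.card_le_card this)
      rw [Finset.card_image_of_injective _ fun w w' h ↦
        congrArg Prod.fst (Sum.inl_injective (e.injective h))]
      simp [ZMod.card]
    · exact Finset.mem_image_of_mem _ (Finset.mem_univ j)

theorem choose_mul_le_choose_mul {m n k : ℕ} (hmn : m ≤ n) (hk : 1 ≤ k) :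
    m.choose k * n ≤ n.choose k * m := by
  obtain ⟨k, rfl⟩ := Nat.exists_eq_add_of_le' hk
  rcases m with _ | m
  · simp
  obtain ⟨n, rfl⟩ := Nat.exists_eq_add_of_le' (show 1 ≤ n by omega)
  have h1 := Nat.add_one_mul_choose_eq m k
  have h2 := Nat.add_one_mul_choose_eq n k
  have h3 : m.choose k ≤ n.choose k := Nat.choose_le_choose k (by omega)
  refine Nat.le_of_mul_le_mul_right (c := k + 1) ?_ (Nat.succ_pos k)
  calc (m + 1).choose (k + 1) * (n + 1) * (k + 1)
      = (m + 1) * m.choose k * (n + 1) := by rw [h1]; ring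
    _ ≤ (m + 1) * n.choose k * (n + 1) := by gcongr
    _ = (n + 1).choose (k + 1) * (m + 1) * (k + 1) := by
      rw [mul_right_comm ((n + 1).choose (k + 1)), ← h2]; ring

theorem choose_le_choose_of_le_half {n q k : ℕ} (hqk : q ≤ k) (hk : 2 * k ≤ n) :
    n.choose q ≤ n.choose k := by
  induction k, hqk using Nat.le_induction with
  | base => rfl
  | succ k _ ih =>
    exact (ih (by omega)).trans (Nat.choose_le_succ_of_lt_half_left (by omega))

theorem two_pow_mul_le_choose_mul {n q : ℕ} (hq : 1 ≤ q) (hqn : 16 * q ≤ n) :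
    2 ^ (3 * q) * n ≤ n.choose q * (16 * q) := by
  have hq0 : (0 : ℝ) < q := by exact_mod_cast hq
  have hqn' : 16 * (q : ℝ) ≤ n := by exact_mod_cast hqn
  set t : ℝ := n / (2 * q) with ht
  have ht8 : 8 ≤ t := by
    rw [ht, le_div_iff₀ (by positivity)]
    linarith
  have h1 : t ^ q ≤ n.choose q := by
    refine le_trans ?_ (Nat.pow_le_choose q n)
    have h2 : (q.factorial : ℝ) ≤ q ^ q := by exact_mod_cast Nat.factorial_le_pow q
    have h3 : (n : ℝ) / 2 ≤ (n + 1 - q : ℕ) := by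
      rw [Nat.cast_sub (by omega)]
      push_cast
      linarith
    calc t ^ q = (n / 2) ^ q / q ^ q := by rw [ht, ← div_pow, div_div]
      _ ≤ ((n + 1 - q : ℕ) : ℝ) ^ q / q.factorial := by gcongr
      _ = _ := rfl
  have h2 : (8 : ℝ) ^ (q - 1) ≤ t ^ (q - 1) := by gcongr
  have h3 : (2 : ℝ) ^ (3 * q) = 8 * 8 ^ (q - 1) := by
    rw [← pow_succ', pow_mul, Nat.sub_add_cancel hq]; norm_num
  have h4 : t ^ q = t * t ^ (q - 1) := by
    rw [← pow_succ', Nat.sub_add_cancel hq]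
  have h5 : t * (2 * q) = n := by rw [ht]; field_simp
  have : (2 : ℝ) ^ (3 * q) * n ≤ n.choose q * (16 * q) := by
    rw [h3]
    calc 8 * 8 ^ (q - 1) * (n : ℝ) ≤ 8 * t ^ (q - 1) * n := by gcongr
      _ = t ^ q * (16 * q) := by rw [h4, ← h5]; ring
      _ ≤ _ := by gcongr
  exact_mod_cast this

theorem exists_prime_pow_sq_between {p : ℕ} (hp : p.Prime) {n : ℕ} (hn : 1 < n) :
    ∃ m, n ≤ (p ^ m) ^ 2 ∧ (p ^ m) ^ 2 < p ^ 2 * n := by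
  have hex : ∃ m, n ≤ (p ^ m) ^ 2 := by
    refine ⟨n, ?_⟩
    have := Nat.lt_pow_self hp.one_lt (n := n)
    nlinarith
  classical
  refine ⟨Nat.find hex, Nat.find_spec hex, ?_⟩
  rcases h : Nat.find hex with _ | m
  · have := Nat.find_spec hex
    rw [h] at this
    simp at this
    omega
  · have := Nat.find_min hex (m := m) (by omega)
    rw [pow_succ p, mul_pow, mul_comm]
    have hp2 : 0 < p ^ 2 := pow_pos hp.pos 2
    exact Nat.mul_lt_mul_of_pos_left (not_le.1 this) hp2

theorem eventually_div_sqrt_le (c : ℝ) {ε : ℝ} (hε : 0 < ε) :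
    ∀ᶠ n : ℕ in atTop, c * √n / n ≤ ε := by
  have : Tendsto (fun n : ℕ ↦ c * (√n)⁻¹) atTop (𝓝 (c * 0)) :=
    ((tendsto_inv_atTop_zero.comp Real.tendsto_sqrt_atTop).comp
      tendsto_natCast_atTop_atTop).const_mul c
  rw [mul_zero] at this
  filter_upwards [this.eventually (eventually_le_nhds hε)] with n hn
  rwa [mul_div_assoc, Real.sqrt_div_self', one_div]

theorem eventually_rpow_sqrt_le (c : ℝ) {ε : ℝ} (hε : 0 < ε) :
    ∀ᶠ n : ℕ in atTop, 2 * (n : ℝ) ^ (c * √n) ≤ ε * 2 ^ ((n : ℝ) / 4) := by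
  have hlog2 : 0 < Real.log 2 := Real.log_pos one_lt_two
  have h1 : ∀ᶠ y : ℝ in atTop, ‖c * Real.log y‖ ≤ Real.log 2 / 8 * ‖y ^ (1 / 2 : ℝ)‖ :=
    ((isLittleO_log_rpow_atTop (by norm_num : (0 : ℝ) < 1 / 2)).const_mul_left c).def
      (by positivity)
  have h2 : ∀ᶠ y : ℝ in atTop, Real.log (2 / ε) ≤ Real.log 2 / 8 * y :=
    (tendsto_id.const_mul_atTop (by positivity : 0 < Real.log 2 / 8)).eventually_ge_atTop _
  filter_upwards [tendsto_natCast_atTop_atTop.eventually h1,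
    tendsto_natCast_atTop_atTop.eventually h2, eventually_gt_atTop 0] with n h1 h2 hn
  have hn0 : (0 : ℝ) < n := by exact_mod_cast hn
  rw [← Real.sqrt_eq_rpow, Real.norm_of_nonneg (Real.sqrt_nonneg _)] at h1
  have h3 : c * Real.log n * √n ≤ Real.log 2 / 8 * n := by
    calc c * Real.log n * √n ≤ Real.log 2 / 8 * √n * √n := by
          exact mul_le_mul_of_nonneg_right ((Real.le_norm_self _).trans h1) (Real.sqrt_nonneg _)
      _ = _ := by rw [mul_assoc, Real.mul_self_sqrt hn0.le]
  have h4 : 2 / ε * (n : ℝ) ^ (c * √n) ≤ 2 ^ ((n : ℝ) / 4) := by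
    rw [← Real.exp_log (show 0 < 2 / ε by positivity), Real.rpow_def_of_pos hn0,
      Real.rpow_def_of_pos two_pos, ← Real.exp_add]
    gcongr
    linarith
  calc 2 * (n : ℝ) ^ (c * √n) = ε * (2 / ε * (n : ℝ) ^ (c * √n)) := by field_simp
    _ ≤ _ := by gcongr

theorem card_fixedBy_bound {α : Type*} [Fintype α] [DecidableEq α] {q : ℕ} (hq : 1 ≤ q)
    (hqα : 16 * q ≤ Fintype.card α) {x : alternatingGroup α} {R F : Finset α}
    (hR : R.card ≤ 3 * q) (hF : F.card ≤ 2 * q)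
    (hRx : ∀ y, ∃ r ∈ R, ∃ i : ℕ, (x ^ i) • r = y)
    (hFx : ∀ s : Finset α, x • s = s → s.card < q → s ⊆ F)
    {Ω : Type*} [Finite Ω] [Nontrivial Ω]
    [MulAction (alternatingGroup α) Ω] [IsPreprimitive (alternatingGroup α) Ω] :
    Nat.card (fixedBy Ω x) * Fintype.card α ≤ Nat.card Ω * (16 * q) ∨
    ∃ j, Fintype.card α ≤ 4 * j ∧
      2 ^ j * Nat.card (fixedBy Ω x) ≤ 2 * Fintype.card α ^ (3 * q) * Nat.card Ω := by
  rcases primitive_action_cases (α := α) (Ω := Ω) (by omega) with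
    ⟨k, hk, hkα, hΩ, hfix⟩ | ⟨j, hj, hΩ⟩
  · left
    rw [hΩ]
    rcases lt_or_ge k q with hkq | hkq
    · have h1 := (hfix x).trans (card_fixedBy_powersetCard_le_choose x F k
        fun s hs hsk ↦ hFx s hs (hsk ▸ hkq))
      calc _ ≤ (F.card).choose k * Fintype.card α := Nat.mul_le_mul_right _ h1
        _ ≤ (Fintype.card α).choose k * F.card := choose_mul_le_choose_mul F.card_le_univ hk
        _ ≤ _ := Nat.mul_le_mul_left _ (by omega)
    · have h1 := (hfix x).trans (card_fixedBy_powersetCard_le_two_pow x R hRx k)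
      calc _ ≤ 2 ^ (3 * q) * Fintype.card α :=
            Nat.mul_le_mul_right _ (h1.trans (Nat.pow_le_pow_right two_pos hR))
        _ ≤ (Fintype.card α).choose q * (16 * q) := two_pow_mul_le_choose_mul hq hqα
        _ ≤ _ := Nat.mul_le_mul_right _ (choose_le_choose_of_le_half hkq hkα)
  · right
    have hne : Nonempty Ω := inferInstance
    have h1 : Nat.card (fixedBy Ω x) ≤ Fintype.card α ^ (3 * q) :=
      (card_fixedBy_le_card_centralizer x).trans ((card_centralizer_le x R hRx).trans
        (Nat.pow_le_pow_right (by omega) hR))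
    refine ⟨j, hj, (Nat.mul_le_mul hΩ h1).trans_eq (by ring)⟩

/-- let `p` be a prime. For every `ε > 0` there is `N` such that for every
`n > N` with `p ≤ n` there is a `p`-element `x` of the alternating group `A_n` such that
for every faithful primitive action of `A_n` on a finite nonempty set `Ω` we have
`fpr(x, Ω) ≤ ε`. -/
theorem stmt8 (p : ℕ) (hp : p.Prime) :
    ∀ ε : ℝ, 0 < ε → ∃ N : ℕ, ∀ n : ℕ, N < n → p ≤ n →
      ∃ x : alternatingGroup (Fin n), (∃ m : ℕ, orderOf x = p ^ m) ∧
        ∀ (Ω : Type) [Fintype Ω] [Nonempty Ω] [MulAction (alternatingGroup (Fin n)) Ω],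
          FaithfulSMul (alternatingGroup (Fin n)) Ω →
          IsPrimitiveAction (alternatingGroup (Fin n)) Ω →
          (Nat.card (MulAction.fixedBy Ω x) : ℝ) / (Nat.card Ω : ℝ) ≤ ε := by
  intro ε hε
  obtain ⟨N, hN⟩ := eventually_atTop.1 (((eventually_div_sqrt_le (16 * p) hε).and
    (eventually_div_sqrt_le (16 * p) one_pos)).and
    ((eventually_rpow_sqrt_le (3 * p) hε).and (eventually_gt_atTop 1)))
  refine ⟨N, fun n hn _ ↦ ?_⟩
  obtain ⟨⟨hA, hA'⟩, hB, hn1⟩ := hN n hn.le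
  have hn0 : (0 : ℝ) < n := by exact_mod_cast (by omega : 0 < n)
  obtain ⟨m, hm, hm'⟩ := exists_prime_pow_sq_between hp hn1
  set q := p ^ m with hqdef
  have hq : 1 ≤ q := Nat.one_le_iff_ne_zero.2 (pow_ne_zero _ hp.ne_zero)
  have hqs : (q : ℝ) ≤ p * √n := by
    rw [← Real.sqrt_sq (Nat.cast_nonneg q), ← Real.sqrt_sq (Nat.cast_nonneg (α := ℝ) p),
      ← Real.sqrt_mul (by positivity)]
    exact Real.sqrt_le_sqrt (by exact_mod_cast hm'.le)
  have hqn : 16 * q ≤ n := by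
    rw [div_le_one hn0] at hA'
    have : 16 * (q : ℝ) ≤ n := by linarith
    exact_mod_cast this
  have hdiv : n = q * (2 * (n / (2 * q))) + n % (2 * q) := by
    have := Nat.div_add_mod n (2 * q)
    linarith
  have hmod : n % (2 * q) < 2 * q := Nat.mod_lt _ (by omega)
  have hcyc : 2 * (n / (2 * q)) ≤ q := by
    refine Nat.le_of_mul_le_mul_left ?_ hq
    calc q * (2 * (n / (2 * q))) = 2 * q * (n / (2 * q)) := by ring
      _ ≤ n := Nat.mul_div_le _ _
      _ ≤ q ^ 2 := hm
      _ = q * q := sq q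
  obtain ⟨x, R, F, hx, hR, hF, hRx, hFx⟩ :=
    exists_even_perm_of_cycles (α := Fin n) hq (by rwa [Fintype.card_fin])
  refine ⟨x, ?_, ?_⟩
  · obtain ⟨k, -, hk⟩ := (Nat.dvd_prime_pow hp).1 (orderOf_dvd_of_pow_eq_one hx)
    exact ⟨k, hk⟩
  intro Ω _ _ _ hfaith hprim
  have hpre : IsPreprimitive (alternatingGroup (Fin n)) Ω :=
    { hprim.1 with isTrivialBlock_of_isBlock := fun {B} hB ↦ hprim.2 B hB }
  have hnt : Nontrivial Ω := by
    have : Nontrivial (alternatingGroup (Fin n)) :=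
      alternatingGroup.nontrivial_of_three_le_card (by rw [Nat.card_fin]; omega)
    by_contra H
    rw [not_nontrivial_iff_subsingleton] at H
    obtain ⟨g, hg⟩ := exists_ne (1 : alternatingGroup (Fin n))
    exact hg (hfaith.eq_of_smul_eq_smul fun _ ↦ Subsingleton.elim _ _)
  have hΩ : (0 : ℝ) < Nat.card Ω := by exact_mod_cast Nat.card_pos
  rw [div_le_iff₀ hΩ]
  have hbound := card_fixedBy_bound (Ω := Ω) hq (by rwa [Fintype.card_fin])
    (hR.trans (by omega)) (hF.trans hmod.le) hRx hFx
  rw [Fintype.card_fin] at hbound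
  rcases hbound with h | ⟨j, hj, h⟩
  · have h : (Nat.card (fixedBy Ω x) : ℝ) * n ≤ Nat.card Ω * (16 * q) := by exact_mod_cast h
    rw [div_le_iff₀ hn0] at hA
    refine le_of_mul_le_mul_right (h.trans ?_) hn0
    calc (Nat.card Ω : ℝ) * (16 * q) ≤ Nat.card Ω * (ε * n) :=
          mul_le_mul_of_nonneg_left (by linarith) hΩ.le
      _ = _ := by ring
  · have h : (2 : ℝ) ^ j * Nat.card (fixedBy Ω x) ≤ 2 * n ^ (3 * q) * Nat.card Ω := by
      exact_mod_cast h
    have h1 : (n : ℝ) ^ (3 * q) ≤ (n : ℝ) ^ (3 * p * √n) := by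
      rw [← Real.rpow_natCast]
      refine Real.rpow_le_rpow_of_exponent_le (by exact_mod_cast hn1.le) ?_
      push_cast
      linarith
    have h2 : (2 : ℝ) ^ ((n : ℝ) / 4) ≤ 2 ^ j := by
      rw [← Real.rpow_natCast]
      refine Real.rpow_le_rpow_of_exponent_le one_le_two ?_
      have : (n : ℝ) ≤ 4 * j := by exact_mod_cast hj
      linarith
    refine le_of_mul_le_mul_left (h.trans ?_) (show (0 : ℝ) < 2 ^ j by positivity)
    calc 2 * (n : ℝ) ^ (3 * q) * Nat.card Ω ≤ 2 * (n : ℝ) ^ (3 * p * √n) * Nat.card Ω := by gcongr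
      _ ≤ ε * 2 ^ ((n : ℝ) / 4) * Nat.card Ω := by gcongr
      _ ≤ ε * 2 ^ j * Nat.card Ω := by gcongr
      _ = _ := by ring
end

section
/- Let p be a prime, let G be a finite group generated by its p-elements, and let H be a proper subgroup of G containing a Sylow p-subgroup of G. Then (2p−1)·ν_p(H) ≤ (p−1)·ν_p(G), i.e., ν_p(H) ≤ ((p−1)/(2p−1))·ν_p(G). -/
namespace Sylow

open scoped Classical Pointwise
open Finset

variable {p : ℕ} {G : Type*} [Group G]

theorem isPGroup_zpowers {P : Sylow p G} {x : G} (hx : x ∈ P) :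
    IsPGroup p (Subgroup.zpowers x) :=
  P.2.to_le (Subgroup.zpowers_le.2 hx)

/-- A `p`-element moving a point has a power for which the orbit of that point has size `p`. -/
theorem exists_smul_ne_pow_smul_eq {X : Type*} [MulAction G X] {P : Sylow p G} {a : X} {y : G}
    (hy : y ∈ P) (hya : y • a ≠ a) : ∃ x ∈ P, x • a ≠ a ∧ x ^ p • a = a := by
  have hex : ∃ k, y ^ p ^ k • a = a := by
    obtain ⟨k, hk⟩ := P.2 ⟨y, hy⟩
    exact ⟨k, by rw [show y ^ p ^ k = 1 from congrArg Subtype.val hk, one_smul]⟩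
  obtain ⟨j, hj⟩ : ∃ j, Nat.find hex = j + 1 :=
    Nat.exists_eq_succ_of_ne_zero fun h => hya (by simpa [h] using Nat.find_spec hex)
  refine ⟨y ^ p ^ j, pow_mem hy _, Nat.find_min hex (by omega), ?_⟩
  rw [← pow_mul, ← pow_succ, ← hj]
  exact Nat.find_spec hex

variable [Finite G]

/-- The Sylow `p`-subgroups of `G` contained in the subgroup `K`. -/
noncomputable def sylowsIn (p : ℕ) {G : Type*} [Group G] [Finite G] (K : Subgroup G) :
    Finset (Sylow p G) :=
  (Set.toFinite {P : Sylow p G | (P : Subgroup G) ≤ K}).toFinset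

@[simp]
theorem mem_sylowsIn {K : Subgroup G} {P : Sylow p G} :
    P ∈ sylowsIn p K ↔ (P : Subgroup G) ≤ K := by
  simp [sylowsIn]

theorem sylowsIn_inter (K L : Subgroup G) :
    sylowsIn p K ∩ sylowsIn p L = sylowsIn p (K ⊓ L) := by
  ext P; simp

theorem smul_sylowsIn (g : G) (K : Subgroup G) :
    g • sylowsIn p K = sylowsIn p (MulAut.conj g • K) := by
  ext P
  rw [← Finset.inv_smul_mem_iff, mem_sylowsIn, mem_sylowsIn, coe_subgroup_smul, map_inv,
    ← Subgroup.subset_pointwise_smul_iff]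

theorem smul_sylowsIn_of_mem {g : G} {K : Subgroup G} (hg : g ∈ K) :
    g • sylowsIn p K = sylowsIn p K := by
  rw [smul_sylowsIn, Subgroup.conj_smul_eq_self_of_mem hg]

theorem exists_mem_smul_eq [Fact p.Prime] {L : Subgroup G} {P Q : Sylow p G}
    (hP : (P : Subgroup G) ≤ L) (hQ : (Q : Subgroup G) ≤ L) : ∃ g ∈ L, g • P = Q := by
  obtain ⟨g, hg⟩ := MulAction.exists_smul_eq L (P.subtype hP) (Q.subtype hQ)
  rw [smul_subtype] at hg
  exact ⟨g, g.2, subtype_injective hg⟩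

/-- If a `p`-element `x` normalizes a subgroup containing a Sylow `p`-subgroup of `G`, then `x`
lies in that subgroup. -/
theorem mem_of_mem_normalizer [Fact p.Prime] {M : Subgroup G} {Q : Sylow p G}
    (hQ : (Q : Subgroup G) ≤ M) {x : G} (hx : IsPGroup p (Subgroup.zpowers x))
    (hxM : x ∈ Subgroup.normalizer (M : Set G)) : x ∈ M := by
  obtain ⟨P, hP⟩ := (hx.comap_subtype (K := Subgroup.normalizer (M : Set G))).exists_le_sylow
  obtain ⟨g, hg⟩ := MulAction.exists_smul_eq (Subgroup.normalizer (M : Set G))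
    (Q.subtype (hQ.trans Subgroup.le_normalizer)) P
  rw [smul_subtype] at hg
  have hxg : x ∈ MulAut.conj (g : G) • (Q : Subgroup G) := by
    have : (⟨x, hxM⟩ : Subgroup.normalizer (M : Set G)) ∈ P := hP (Subgroup.mem_zpowers x)
    rw [← hg] at this
    exact this
  rw [Subgroup.mem_pointwise_smul_iff_inv_smul_mem, ← map_inv, MulAut.smul_def,
    MulAut.conj_apply, inv_inv] at hxg
  exact (Subgroup.mem_normalizer_iff''.1 g.2 x).2 (hQ hxg)

theorem mem_of_forall_mem_smul [Fact p.Prime] {K : Subgroup G} {Q : Sylow p G} {x : G}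
    (hx : IsPGroup p (Subgroup.zpowers x))
    (hQ : ∀ i : ℤ, Q ∈ x ^ i • sylowsIn p K) : x ∈ K := by
  set M : Subgroup G := ⨅ i : ℤ, MulAut.conj (x ^ i) • K with hM
  have hQM : (Q : Subgroup G) ≤ M := by
    refine le_iInf fun i => ?_
    simpa [smul_sylowsIn] using hQ i
  have hMK : M ≤ K := (iInf_le _ 0).trans (by simp)
  have hmem : ∀ h, h ∈ M ↔ ∀ i : ℤ, x ^ (-i) * h * x ^ i ∈ K := fun h => by
    rw [hM, Subgroup.mem_iInf]
    refine forall_congr' fun i => ?_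
    rw [Subgroup.mem_pointwise_smul_iff_inv_smul_mem, ← map_inv, MulAut.smul_def,
      MulAut.conj_apply, inv_inv, zpow_neg]
  have hxM : x ∈ Subgroup.normalizer (M : Set G) := by
    refine Subgroup.mem_normalizer_iff.2 fun h => ?_
    simp only [hmem]
    refine (Equiv.addRight (1 : ℤ)).forall_congr fun i => ?_
    rw [Equiv.coe_addRight, show x ^ (-(i + 1)) * (x * h * x⁻¹) * x ^ (i + 1) =
      x ^ (-i) * h * x ^ i by group]
  exact hMK (mem_of_mem_normalizer hQM hx hxM)

theorem mem_sylowsIn_of_forall_smul_eq [Fact p.Prime] {K : Subgroup G} {P : Sylow p G}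
    (hK : (sylowsIn p K).Nonempty) (hP : ∀ x ∈ P, x • sylowsIn p K = sylowsIn p K) :
    P ∈ sylowsIn p K := by
  obtain ⟨Q, hQ⟩ := hK
  rw [mem_sylowsIn]
  intro x hx
  refine mem_of_forall_mem_smul (isPGroup_zpowers hx) (Q := Q) fun i => ?_
  rwa [hP _ (zpow_mem hx i)]

/-- A `P`-invariant family of families `sylowsIn p K` has at least `p` members if some nonempty
member does not contain `P`. -/
theorem le_card_of_smul_mem [Fact p.Prime] {E : Finset (Finset (Sylow p G))} {P : Sylow p G}
    (hE : ∀ g ∈ P, ∀ w ∈ E, g • w ∈ E) {K : Subgroup G} (hKE : sylowsIn p K ∈ E)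
    (hK : (sylowsIn p K).Nonempty) (hP : P ∉ sylowsIn p K) : p ≤ #E := by
  set O := MulAction.orbit P (sylowsIn p K) with hO
  have hOE : O ⊆ E := by
    rintro _ ⟨g, rfl⟩
    exact hE g g.2 _ hKE
  have hfin : Finite O := (E.finite_toSet.subset hOE)
  obtain ⟨n, hn⟩ := P.2.card_orbit (sylowsIn p K)
  have hn0 : n ≠ 0 := by
    rintro rfl
    rw [pow_zero, Nat.card_eq_one_iff_unique] at hn
    have := hn.1
    refine hP (mem_sylowsIn_of_forall_smul_eq hK fun x hx => ?_)
    exact congrArg Subtype.val (Subsingleton.elim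
      (⟨(⟨x, hx⟩ : P) • sylowsIn p K, MulAction.mem_orbit _ _⟩ : O)
      ⟨sylowsIn p K, MulAction.mem_orbit_self _⟩)
  calc p ≤ p ^ n := Nat.le_self_pow hn0 p
    _ = Nat.card O := hn.symm
    _ ≤ Nat.card (E : Set (Finset (Sylow p G))) := Nat.card_mono E.finite_toSet hOE
    _ = #E := by simp

/-- Measures how far `w` is from having `(p - 1) / (2 * p - 1)` times the size of `t`. -/
noncomputable def defect {α : Type*} (p : ℕ) (t w : Finset α) : ℚ :=
  (p - 1) - (2 * p - 1) * (#w / #t)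

theorem defect_nonneg_iff {α : Type*} {t w : Finset α} (ht : t.Nonempty) :
    0 ≤ defect p t w ↔ (2 * p - 1 : ℚ) * #w ≤ (p - 1) * #t := by
  have : (0 : ℚ) < #t := by exact_mod_cast ht.card_pos
  rw [defect, sub_nonneg, ← mul_div_assoc, div_le_iff₀ this]

/-- The total defect of an invariant family is the same with respect to smaller subgroups that
still contain a Sylow subgroup. -/
theorem sum_defect_inter [Fact p.Prime] {L : Subgroup G} {W : Finset (Finset (Sylow p G))}
    (hW : ∀ g ∈ L, ∀ w ∈ W, g • w ∈ W) {t : Finset (Sylow p G)} (htL : t ⊆ sylowsIn p L)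
    (ht : t.Nonempty) :
    ∑ w ∈ W, defect p t (w ∩ t) =
      ∑ w ∈ W, defect p (sylowsIn p L) (w ∩ sylowsIn p L) := by
  obtain ⟨P, hP⟩ := ht
  have hconst : ∀ Q ∈ sylowsIn p L, #{w ∈ W | Q ∈ w} = #{w ∈ W | P ∈ w} := by
    intro Q hQ
    obtain ⟨g, hgL, rfl⟩ := exists_mem_smul_eq (mem_sylowsIn.1 hQ) (mem_sylowsIn.1 (htL hP))
    refine Finset.card_nbij' (g • ·) (g⁻¹ • ·) ?_ ?_ ?_ ?_
    · intro w hw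
      simp only [mem_coe, mem_filter] at hw ⊢
      exact ⟨hW g hgL w hw.1, by simpa using hw.2⟩
    · intro w hw
      simp only [mem_coe, mem_filter] at hw ⊢
      exact ⟨hW _ (inv_mem hgL) w hw.1, by simpa [Finset.mem_inv_smul_finset_iff] using hw.2⟩
    · intro w _; simp
    · intro w _; simp
  have key : ∀ u ⊆ sylowsIn p L, u.Nonempty →
      ∑ w ∈ W, defect p u (w ∩ u) = #W * (p - 1) - (2 * p - 1) * #{w ∈ W | P ∈ w} := by
    intro u hu hne
    have h0 : (#u : ℚ) ≠ 0 := by exact_mod_cast hne.card_pos.ne'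
    have h1 : (∑ w ∈ W, (#(w ∩ u) : ℚ)) = #u * #{w ∈ W | P ∈ w} := by
      have := Finset.sum_card_inter (s := u) (B := W) fun Q hQ => hconst Q (hu hQ)
      simp_rw [inter_comm u] at this
      exact_mod_cast this
    simp only [defect, sum_sub_distrib, sum_const, nsmul_eq_mul]
    rw [← mul_sum, ← sum_div, h1]
    field_simp
  rw [key t htL ⟨P, hP⟩, key _ subset_rfl ⟨P, htL hP⟩]

/-- Under a bound on the total defect of an invariant family, any `c` members of it have a common
element. -/
theorem exists_forall_mem_of_sum_defect_lt [hp : Fact p.Prime] {n : ℕ}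
    (hmain : ∀ K L : Subgroup G, #(sylowsIn p L) < n → sylowsIn p K ⊂ sylowsIn p L →
      0 ≤ defect p (sylowsIn p L) (sylowsIn p K)) (c : ℕ) :
    ∀ (L : Subgroup G) (W S : Finset (Finset (Sylow p G))),
      (sylowsIn p L).Nonempty → #(sylowsIn p L) ≤ n →
      (∀ g ∈ L, ∀ w ∈ W, g • w ∈ W) →
      (∀ w ∈ W, w.Nonempty ∧ w ⊂ sylowsIn p L ∧ ∃ K, w = sylowsIn p K) →
      (∀ w ∈ W, ∀ w' ∈ W, #w' < #w → 0 ≤ defect p (sylowsIn p L) w) →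
      ∑ w ∈ W, defect p (sylowsIn p L) w < p * (p - c) →
      S ⊆ W → #S ≤ c → ∃ Q ∈ sylowsIn p L, ∀ w ∈ S, Q ∈ w := by
  induction c with
  | zero =>
    intro L W S hL _ _ _ _ _ _ hS
    obtain ⟨Q, hQ⟩ := hL
    rw [Nat.le_zero, card_eq_zero] at hS
    exact ⟨Q, hQ, by simp [hS]⟩
  | succ c ih =>
    intro L W S hL hLn hinv hW hpos hsum hSW hS
    rcases S.eq_empty_or_nonempty with rfl | hSne
    · obtain ⟨Q, hQ⟩ := hL
      exact ⟨Q, hQ, by simp⟩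
    obtain ⟨a, haS, hamax⟩ := S.exists_max_image Finset.card hSne
    obtain ⟨hane, haL, A, hA⟩ := hW a (hSW haS)
    rcases (S.erase a).eq_empty_or_nonempty with hSa | hSa
    · obtain ⟨Q, hQ⟩ := hane
      refine ⟨Q, haL.1 hQ, fun w hw => ?_⟩
      by_cases hwa : w = a
      · rwa [hwa]
      · simpa [hSa] using mem_erase.2 ⟨hwa, hw⟩
    have hcS : #(S.erase a) ≤ c := by rw [card_erase_of_mem haS]; omega
    have hc : 1 ≤ c := hSa.card_pos.trans_le hcS
    set W₀ := W.filter fun w => #w ≤ #a with hW₀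
    have haW₀ : a ∈ W₀ := mem_filter.2 ⟨hSW haS, le_rfl⟩
    have hinv₀ : ∀ g ∈ L, ∀ w ∈ W₀, g • w ∈ W₀ := by
      intro g hg w hw
      rw [hW₀, mem_filter] at hw ⊢
      exact ⟨hinv g hg w hw.1, by simpa using hw.2⟩
    have haA : a = sylowsIn p (A ⊓ L) := by
      rw [← sylowsIn_inter, ← hA, inter_eq_left.2 haL.1]
    have hfix : ∀ g ∈ A ⊓ L, g • a = a := fun g hg => by
      rw [haA, smul_sylowsIn_of_mem hg]
    have hinvE : ∀ g ∈ A ⊓ L, ∀ w ∈ W₀.erase a, g • w ∈ W₀.erase a := by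
      intro g hg w hw
      rw [mem_erase] at hw ⊢
      refine ⟨fun h => hw.1 ?_, hinv₀ g hg.2 w hw.2⟩
      rw [← hfix g hg] at h
      exact smul_left_cancel g h
    have hflat : ∀ w ∈ W₀.erase a, w ∩ a ⊂ a ∧ ∃ K, w ∩ a = sylowsIn p K := by
      intro w hw
      rw [mem_erase, hW₀, mem_filter] at hw
      obtain ⟨-, -, K, rfl⟩ := hW w hw.2.1
      refine ⟨⟨inter_subset_right, fun h => hw.1 ?_⟩, _, by rw [hA, sylowsIn_inter]⟩
      exact (eq_of_subset_of_card_le (h.trans inter_subset_left) hw.2.2).symm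
    have hnonneg : ∀ w ∈ W₀.erase a, 0 ≤ defect p a (w ∩ a) := by
      intro w hw
      obtain ⟨hlt, K, hK⟩ := hflat w hw
      rw [hK, haA] at hlt ⊢
      refine hmain _ _ ?_ hlt
      rw [← haA]
      exact (card_lt_card haL).trans_le hLn
    have hsum₀ : ∑ w ∈ W₀.erase a, defect p a (w ∩ a) < p * (p - c) := by
      have h1 : ∑ w ∈ W₀, defect p (sylowsIn p L) w ≤ ∑ w ∈ W, defect p (sylowsIn p L) w := by
        refine sum_le_sum_of_subset_of_nonneg (filter_subset _ _) fun w hw hw' => ?_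
        refine hpos w hw a (hSW haS) ?_
        simpa [hW₀, hw] using hw'
      have h2 := sum_defect_inter hinv₀ haL.1 hane
      have h3 : ∑ w ∈ W₀, defect p (sylowsIn p L) (w ∩ sylowsIn p L) =
          ∑ w ∈ W₀, defect p (sylowsIn p L) w := by
        refine sum_congr rfl fun w hw => ?_
        rw [inter_eq_left.2 (hW w (mem_filter.1 hw).1).2.1.1]
      have h4 : defect p a (a ∩ a) = -p := by
        have : (#a : ℚ) ≠ 0 := by exact_mod_cast hane.card_pos.ne'
        rw [inter_self, defect, div_self this]
        ring
      rw [← add_sum_erase _ _ haW₀, h4, h3] at h2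
      push_cast at hsum
      linarith
    have hmeet : ∀ w ∈ W₀.erase a, (w ∩ a).Nonempty := by
      intro v hv
      by_contra hva
      rw [not_nonempty_iff_eq_empty] at hva
      obtain ⟨hvne, -, K, rfl⟩ := hW v (mem_filter.1 (mem_of_mem_erase hv)).1
      obtain ⟨P, hP⟩ := hane
      set E := (W₀.erase a).filter fun w => w ∩ a = ∅ with hE
      have hPA : (P : Subgroup G) ≤ A ⊓ L := by rwa [haA, mem_sylowsIn] at hP
      have hpE : p ≤ #E := by
        refine le_card_of_smul_mem (P := P) (K := K) ?_ (mem_filter.2 ⟨hv, hva⟩) hvne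
          fun hPv => by simpa [hva] using mem_inter.2 ⟨hPv, hP⟩
        intro g hg w hw
        rw [hE, mem_filter] at hw ⊢
        refine ⟨hinvE g (hPA hg) w hw.1, ?_⟩
        rw [← hfix g (hPA hg), ← Finset.smul_finset_inter, hw.2, smul_finset_empty]
      have h1 : ∑ w ∈ E, defect p a (w ∩ a) ≤ ∑ w ∈ W₀.erase a, defect p a (w ∩ a) :=
        sum_le_sum_of_subset_of_nonneg (filter_subset _ _) fun w hw _ => hnonneg w hw
      have h2 : ∑ w ∈ E, defect p a (w ∩ a) = #E * (p - 1) := by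
        rw [sum_congr rfl fun w hw => by rw [(mem_filter.1 hw).2], sum_const, nsmul_eq_mul]
        simp [defect]
      have hp1 : (1 : ℚ) < p := by exact_mod_cast hp.out.one_lt
      have hpE' : (p : ℚ) ≤ #E := by exact_mod_cast hpE
      have hc' : (1 : ℚ) ≤ c := by exact_mod_cast hc
      nlinarith
    have hW₁ : ∀ w ∈ (W₀.erase a).image (· ∩ a),
        w.Nonempty ∧ w ⊂ a ∧ (∃ K, w = sylowsIn p K) ∧ 0 ≤ defect p a w := by
      intro w hw
      obtain ⟨v, hv, rfl⟩ := mem_image.1 hw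
      exact ⟨hmeet v hv, (hflat v hv).1, (hflat v hv).2, hnonneg v hv⟩
    obtain ⟨Q, hQa, hQ⟩ := ih (A ⊓ L) ((W₀.erase a).image (· ∩ a)) ((S.erase a).image (· ∩ a))
      (haA ▸ hane) (haA ▸ (card_lt_card haL).le.trans hLn)
      (by
        intro g hg w hw
        obtain ⟨v, hv, rfl⟩ := mem_image.1 hw
        refine mem_image.2 ⟨g • v, hinvE g hg v hv, ?_⟩
        rw [Finset.smul_finset_inter, hfix g hg])
      (by rw [← haA]; exact fun w hw => ⟨(hW₁ w hw).1, (hW₁ w hw).2.1, (hW₁ w hw).2.2.1⟩)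
      (by rw [← haA]; exact fun w hw _ _ _ => (hW₁ w hw).2.2.2)
      (by
        rw [← haA]
        exact (sum_image_le_of_nonneg fun w hw => (hW₁ w hw).2.2.2).trans_lt hsum₀)
      (by
        refine image_subset_image (erase_subset_erase _ fun w hw => ?_)
        exact mem_filter.2 ⟨hSW hw, hamax w hw⟩)
      (card_image_le.trans hcS)
    rw [← haA] at hQa
    refine ⟨Q, haL.1 hQa, fun w hw => ?_⟩
    by_cases hwa : w = a
    · rwa [hwa]
    · exact (mem_inter.1 (hQ _ (mem_image_of_mem _ (mem_erase.2 ⟨hwa, hw⟩)))).1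

theorem defect_sylowsIn_nonneg [hp : Fact p.Prime] (n : ℕ) :
    ∀ K L : Subgroup G, #(sylowsIn p L) < n → sylowsIn p K ⊂ sylowsIn p L →
      0 ≤ defect p (sylowsIn p L) (sylowsIn p K) := by
  induction n with
  | zero => intro K L h; omega
  | succ n ih =>
    intro K L hLn hKL
    by_contra! hneg
    have hp1 : (1 : ℚ) < p := by exact_mod_cast hp.out.one_lt
    have hKne : (sylowsIn p K).Nonempty := by
      by_contra h
      rw [not_nonempty_iff_eq_empty] at h
      simp only [defect, h, card_empty, Nat.cast_zero, zero_div, mul_zero, sub_zero] at hneg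
      linarith
    obtain ⟨P, hPL, hPK⟩ := exists_of_ssubset hKL
    obtain ⟨y, hyP, hy⟩ : ∃ y ∈ P, y • sylowsIn p K ≠ sylowsIn p K := by
      by_contra! h
      exact hPK (mem_sylowsIn_of_forall_smul_eq hKne h)
    obtain ⟨x, hxP, hx, hxp⟩ := exists_smul_ne_pow_smul_eq hyP hy
    set W := (Set.toFinite (MulAction.orbit L (sylowsIn p K))).toFinset with hW
    have hmemW : ∀ {w}, w ∈ W ↔ ∃ g ∈ L, g • sylowsIn p K = w := by
      intro w
      rw [hW, Set.Finite.mem_toFinset]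
      exact ⟨fun ⟨g, hg⟩ => ⟨g, g.2, hg⟩, fun ⟨g, hg, h⟩ => ⟨⟨g, hg⟩, h⟩⟩
    have hcard : ∀ w ∈ W, #w = #(sylowsIn p K) := by
      intro w hw
      obtain ⟨g, -, rfl⟩ := hmemW.1 hw
      exact card_smul_finset _ _
    have hKW : sylowsIn p K ∈ W := hmemW.2 ⟨1, one_mem _, one_smul _ _⟩
    obtain ⟨Q, -, hQ⟩ := exists_forall_mem_of_sum_defect_lt ih p L W
      ((range p).image fun j => x ^ j • sylowsIn p K) ⟨P, hPL⟩ (by omega)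
      (by
        intro g hg w hw
        obtain ⟨k, hk, rfl⟩ := hmemW.1 hw
        exact hmemW.2 ⟨g * k, mul_mem hg hk, mul_smul _ _ _⟩)
      (by
        intro w hw
        obtain ⟨g, hg, rfl⟩ := hmemW.1 hw
        refine ⟨hKne.smul_finset, ?_, _, smul_sylowsIn _ _⟩
        rw [← smul_sylowsIn_of_mem hg]
        exact ⟨smul_finset_subset_smul_finset hKL.1,
          fun h => hKL.2 (smul_finset_subset_smul_finset_iff.1 h)⟩)
      (fun w hw w' hw' h => by rw [hcard w hw, hcard w' hw'] at h; omega)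
      (by
        rw [sub_self, mul_zero]
        refine sum_neg (fun w hw => ?_) ⟨_, hKW⟩
        simpa only [defect, hcard w hw] using hneg)
      (by
        intro w hw
        obtain ⟨j, -, rfl⟩ := mem_image.1 hw
        exact hmemW.2 ⟨x ^ j, pow_mem (mem_sylowsIn.1 hPL hxP) j, rfl⟩)
      (card_image_le.trans (card_range p).le)
    refine hx (smul_sylowsIn_of_mem (mem_of_forall_mem_smul (isPGroup_zpowers hxP) (Q := Q) ?_))
    intro i
    have hp0 : (p : ℤ) ≠ 0 := by exact_mod_cast hp.out.ne_zero
    obtain ⟨j, hj⟩ := Int.eq_ofNat_of_zero_le (Int.emod_nonneg i hp0)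
    have hjp : j < p := by
      have := Int.emod_lt_of_pos i (by exact_mod_cast hp.out.pos : (0 : ℤ) < p)
      omega
    have hi : x ^ i • sylowsIn p K = x ^ j • sylowsIn p K := by
      rw [← Int.emod_add_mul_ediv i p, hj, zpow_add, mul_smul, zpow_mul, zpow_natCast,
        zpow_natCast]
      congr 1
      exact (MulAction.stabilizer G (sylowsIn p K)).zpow_mem hxp (i / p)
    rw [hi]
    exact hQ _ (mem_image_of_mem _ (mem_range.2 hjp))

theorem card_sylowsIn [Fact p.Prime] {H : Subgroup G} {P : Sylow p G}
    (hP : (P : Subgroup G) ≤ H) : #(sylowsIn p H) = Nat.card (Sylow p H) := by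
  rw [← Nat.card_eq_finsetCard]
  refine Nat.card_congr (Equiv.ofBijective
    (fun Q : sylowsIn p H => (Q : Sylow p G).subtype (mem_sylowsIn.1 Q.2)) ⟨?_, fun R => ?_⟩)
  · exact fun Q R h => Subtype.ext (subtype_injective h)
  · obtain ⟨h, rfl⟩ := MulAction.exists_smul_eq H (P.subtype hP) R
    exact ⟨⟨h • P, mem_sylowsIn.2 (smul_le hP h)⟩, (smul_subtype hP h).symm⟩

theorem card_sylowsIn_top : #(sylowsIn p (⊤ : Subgroup G)) = Nat.card (Sylow p G) := by
  rw [← Nat.card_eq_finsetCard]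
  exact Nat.card_congr (Equiv.subtypeUnivEquiv fun P => by simp)

end Sylow

/-- let `p` be a prime, `G` a finite group generated by its `p`-elements,
and `H` a proper subgroup of `G` containing a Sylow `p`-subgroup of `G`. Then
`(2p-1) ⬝ ν_p(H) ≤ (p-1) ⬝ ν_p(G)`. -/
theorem stmt12 (p : ℕ) (hp : p.Prime) (G : Type) [Group G] [Finite G]
    (hgen : Subgroup.closure {x : G | ∃ n : ℕ, orderOf x = p ^ n} = ⊤)
    (H : Subgroup G) (hH : H ≠ ⊤) (P : Sylow p G) (hP : (P : Subgroup G) ≤ H) :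
    (2 * p - 1) * Nat.card (Sylow p H) ≤ (p - 1) * Nat.card (Sylow p G) := by
  have : Fact p.Prime := ⟨hp⟩
  have hlt : Sylow.sylowsIn p H ⊂ Sylow.sylowsIn p (⊤ : Subgroup G) := by
    refine ⟨fun Q _ => by simp, fun h => hH (top_le_iff.1 ?_)⟩
    rw [← hgen, Subgroup.closure_le]
    rintro x ⟨n, hn⟩
    obtain ⟨Q, hQ⟩ := (IsPGroup.of_card (p := p) (n := n)
      ((Nat.card_zpowers x).trans hn)).exists_le_sylow
    have hQH : Q ∈ Sylow.sylowsIn p H := h (by simp)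
    exact Sylow.mem_sylowsIn.1 hQH (hQ (Subgroup.mem_zpowers x))
  have key := Sylow.defect_sylowsIn_nonneg _ H ⊤ (Nat.lt_succ_self _) hlt
  rw [Sylow.defect_nonneg_iff ⟨P, by simp⟩, Sylow.card_sylowsIn hP,
    Sylow.card_sylowsIn_top] at key
  have h1 := hp.one_le
  zify [h1, show 1 ≤ 2 * p by omega]
  exact_mod_cast key
end

section
/- Let p be a prime. For every natural number k there exists N such that every finite simple group G with p dividing |G| and |G| > N contains a set of more than k p-elements that pairwise do not commute; that is, n_p(G) > k, where n_p(G) is the largest size of a set of pairwise noncommuting p-elements of G. -/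
open Pointwise

/-- The Ramsey theorem for two colours, on pairs of a finite set of natural numbers. -/
theorem exists_ramsey_bound (s t : ℕ) : ∃ N : ℕ, ∀ (A : Finset ℕ) (r : ℕ → ℕ → Prop), N ≤ A.card →
    (∃ B ⊆ A, s ≤ B.card ∧ ∀ i ∈ B, ∀ j ∈ B, i < j → r i j) ∨
    (∃ B ⊆ A, t ≤ B.card ∧ ∀ i ∈ B, ∀ j ∈ B, i < j → ¬ r i j) := by
  classical
  induction s generalizing t with
  | zero => exact ⟨0, fun A r _ => Or.inl ⟨∅, by simp⟩⟩
  | succ s ihs =>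
    induction t with
    | zero => exact ⟨0, fun A r _ => Or.inr ⟨∅, by simp⟩⟩
    | succ t iht =>
      obtain ⟨N₁, h₁⟩ := ihs (t + 1)
      obtain ⟨N₂, h₂⟩ := iht
      refine ⟨N₁ + N₂ + 1, fun A r hA => ?_⟩
      have hne : A.Nonempty := Finset.card_pos.mp (by omega)
      set m := A.min' hne
      have hmA : m ∈ A := A.min'_mem hne
      have hlt : ∀ i ∈ A.erase m, m < i := fun i hi => by
        have h1 := A.min'_le i (Finset.mem_of_mem_erase hi)
        have h2 := Finset.ne_of_mem_erase hi
        omega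
      have hcard := Finset.card_erase_of_mem hmA
      have hsplit := Finset.card_filter_add_card_filter_not (s := A.erase m) (fun i => r m i)
      have extend : ∀ (q : ℕ → ℕ → Prop) (B : Finset ℕ) (c : ℕ),
          (∀ i ∈ B, i ∈ A.erase m ∧ q m i) → c ≤ B.card →
          (∀ i ∈ B, ∀ j ∈ B, i < j → q i j) →
          ∃ B ⊆ A, c + 1 ≤ B.card ∧ ∀ i ∈ B, ∀ j ∈ B, i < j → q i j := by
        intro q B c hB hc hq
        have hB' : ∀ i ∈ B, i ∈ A ∧ m < i ∧ q m i := fun i hi => by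
          have h := hB i hi
          exact ⟨Finset.mem_of_mem_erase h.1, hlt i h.1, h.2⟩
        have hmB : m ∉ B := fun h => lt_irrefl _ (hB' m h).2.1
        refine ⟨insert m B, ?_, ?_, ?_⟩
        · intro i hi
          rcases Finset.mem_insert.mp hi with rfl | hi
          · exact hmA
          · exact (hB' i hi).1
        · rw [Finset.card_insert_of_notMem hmB]; omega
        · intro i hi j hj hij
          rcases Finset.mem_insert.mp hi with rfl | hi <;>
            rcases Finset.mem_insert.mp hj with hj | hj
          · omega
          · exact (hB' j hj).2.2
          · have := (hB' i hi).2.1; omega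
          · exact hq i hi j hj hij
      have hsub : ∀ (q : ℕ → Prop) [DecidablePred q], (A.erase m).filter q ⊆ A := fun q _ =>
        (Finset.filter_subset _ _).trans (Finset.erase_subset _ _)
      by_cases hbig : N₁ ≤ ((A.erase m).filter (fun i => r m i)).card
      · rcases h₁ _ r hbig with ⟨B, hB, hc, hr⟩ | ⟨B, hB, hc, hr⟩
        · exact Or.inl (extend r B s (fun i hi => Finset.mem_filter.mp (hB hi)) hc hr)
        · exact Or.inr ⟨B, hB.trans (hsub _), hc, hr⟩
      · rcases h₂ ((A.erase m).filter (fun i => ¬ r m i)) r (by omega) with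
          ⟨B, hB, hc, hr⟩ | ⟨B, hB, hc, hr⟩
        · exact Or.inl ⟨B, hB.trans (hsub _), hc, hr⟩
        · exact Or.inr (extend (fun i j => ¬ r i j) B t
            (fun i hi => Finset.mem_filter.mp (hB hi)) hc hr)

theorem exists_increasing_enumeration (B : Finset ℕ) {m : ℕ} (hm : m ≤ B.card) :
    ∃ e : ℕ → ℕ, (∀ i < m, e i ∈ B) ∧ ∀ i j, i < j → j < m → e i < e j := by
  refine ⟨fun i => if h : i < B.card then B.orderEmbOfFin rfl ⟨i, h⟩ else 0, ?_, ?_⟩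
  · intro i hi
    simp [lt_of_lt_of_le hi hm]
  · intro i j hij hj
    have h1 : j < B.card := by omega
    have h2 : i < B.card := by omega
    simp [h1, h2, hij]

section NoncommutingSets

variable {G : Type*} [Group G]

/-- Every set of pairwise noncommuting elements of `X` has at most `k` elements. -/
def NoncommutingBound (X : Set G) (k : ℕ) : Prop :=
  ∀ S : Finset G, (∀ x ∈ S, x ∈ X) → (∀ x ∈ S, ∀ y ∈ S, x ≠ y → ¬ Commute x y) → S.card ≤ k

/-- The product of two commuting elements of `X` lies in `X`. -/
def CommutingMulClosed (X : Set G) : Prop :=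
  ∀ x ∈ X, ∀ y ∈ X, Commute x y → x * y ∈ X

theorem NoncommutingBound.card_le {X : Set G} {k : ℕ} (hX : NoncommutingBound X k)
    (B : Finset ℕ) (w : ℕ → G) (hw : ∀ i ∈ B, w i ∈ X)
    (hc : ∀ i ∈ B, ∀ j ∈ B, i < j → ¬ Commute (w i) (w j)) : B.card ≤ k := by
  classical
  have hc' : ∀ i ∈ B, ∀ j ∈ B, i ≠ j → ¬ Commute (w i) (w j) := by
    intro i hi j hj hij h
    rcases lt_or_gt_of_ne hij with h1 | h1
    · exact hc i hi j hj h1 h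
    · exact hc j hj i hi h1 h.symm
  have hinj : Set.InjOn w B := by
    intro i hi j hj hij
    by_contra hne
    exact hc' i hi j hj hne (hij ▸ Commute.refl (w i))
  rw [← Finset.card_image_of_injOn hinj]
  refine hX _ ?_ ?_
  · intro x hx
    obtain ⟨i, hi, rfl⟩ := Finset.mem_image.mp hx
    exact hw i hi
  · intro x hx y hy hxy
    obtain ⟨i, hi, rfl⟩ := Finset.mem_image.mp hx
    obtain ⟨j, hj, rfl⟩ := Finset.mem_image.mp hy
    exact hc' i hi j hj (fun h => hxy (h ▸ rfl))

/-- `y 0 * y 1 * ⋯ * y (n - 1)`. -/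
def initialProd (y : ℕ → G) : ℕ → G
  | 0 => 1
  | n + 1 => initialProd y n * y n

theorem commute_initialProd (y : ℕ → G) (g : G) (n : ℕ) (h : ∀ i < n, Commute g (y i)) :
    Commute g (initialProd y n) := by
  induction n with
  | zero => exact Commute.one_right g
  | succ n ih => exact (ih fun i hi => h i (by omega)).mul_right (h n (by omega))

theorem initialProd_mem {X : Set G} (hmul : CommutingMulClosed X) (hone : (1 : G) ∈ X)
    (y : ℕ → G) (n : ℕ) (hy : ∀ i < n, y i ∈ X)
    (hc : ∀ i < n, ∀ j < n, Commute (y i) (y j)) : initialProd y n ∈ X := by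
  induction n with
  | zero => exact hone
  | succ n ih =>
    exact hmul _ (ih (fun i hi => hy i (by omega)) fun i hi j hj => hc i (by omega) j (by omega)) _
      (hy n (by omega)) (commute_initialProd y _ n fun i hi => hc n (by omega) i (by omega)).symm

theorem not_commute_initialProd (y : ℕ → G) (g : G) (i n : ℕ) (hin : i < n)
    (hi : ¬ Commute g (y i)) (h : ∀ j < n, j ≠ i → Commute g (y j)) :
    ¬ Commute g (initialProd y n) := by
  induction n with
  | zero => omega
  | succ n ih =>
    intro hg
    rcases Nat.lt_or_ge i n with hlt | hge
    · refine ih hlt (fun j hj => h j (by omega)) ?_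
      have := hg.mul_right (h n (by omega) (by omega)).inv_right
      simpa [initialProd] using this
    · obtain rfl : i = n := by omega
      refine hi ?_
      have := (commute_initialProd y g i fun j hj => h j (by omega) (by omega)).inv_right.mul_right
        hg
      simpa [initialProd] using this

/-- Pairwise commuting families whose only noncommuting pairs are `z i, y i` have bounded length. -/
theorem NoncommutingBound.le_of_matching {X : Set G} {k m : ℕ} (hX : NoncommutingBound X k)
    (hmul : CommutingMulClosed X) (hone : (1 : G) ∈ X) (z y : ℕ → G)
    (hz : ∀ i < m, z i ∈ X) (hy : ∀ i < m, y i ∈ X)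
    (hzz : ∀ i < m, ∀ j < m, Commute (z i) (z j)) (hyy : ∀ i < m, ∀ j < m, Commute (y i) (y j))
    (hzy : ∀ i < m, ∀ j < m, i ≠ j → Commute (z i) (y j)) (hd : ∀ i < m, ¬ Commute (z i) (y i)) :
    m ≤ k := by
  have hcq : ∀ i < m, Commute (z i) (initialProd y i) := fun i hi =>
    commute_initialProd y _ i fun j hj => hzy i hi j (by omega) (by omega)
  have key := hX.card_le (Finset.range m) (fun i => initialProd y i * z i) ?_ ?_
  · simpa using key
  · intro i hi
    have hi := Finset.mem_range.mp hi
    exact hmul _ (initialProd_mem hmul hone y i (fun j hj => hy j (by omega))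
      fun j hj l hl => hyy j (by omega) l (by omega)) _ (hz i hi) (hcq i hi).symm
  · intro i hi j hj hij hcomm
    have hi := Finset.mem_range.mp hi
    have hj := Finset.mem_range.mp hj
    have hqq : Commute (initialProd y i) (initialProd y j) :=
      commute_initialProd y _ j fun l hl =>
        (commute_initialProd y _ i fun l' hl' => hyy l (by omega) l' (by omega)).symm
    have hqz : Commute (initialProd y i) (z j) :=
      (commute_initialProd y _ i fun l hl => hzy j hj l (by omega) (by omega)).symm
    have h1 : Commute (z i) (initialProd y j * z j) := by
      have := (hqq.mul_right hqz).inv_left.mul_left hcomm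
      simpa using this
    have h2 : Commute (z i) (initialProd y j) := by
      have := h1.mul_right (hzz i hi j hj).inv_right
      simpa using this
    exact not_commute_initialProd y (z i) i j hij (hd i hi)
      (fun l hl hne => hzy i hi l (by omega) (Ne.symm hne)) h2

/-- Commuting families forming a half graph for noncommutation have bounded length. -/
theorem NoncommutingBound.le_of_halfGraph {X : Set G} {k m : ℕ} (hX : NoncommutingBound X k)
    (hmul : CommutingMulClosed X) (z y : ℕ → G)
    (hz : ∀ i < m + 1, z i ∈ X) (hy : ∀ i < m + 1, y i ∈ X)
    (hzz : ∀ i < m + 1, ∀ j < m + 1, Commute (z i) (z j))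
    (hyy : ∀ i < m + 1, ∀ j < m + 1, Commute (y i) (y j))
    (hlt : ∀ i < m + 1, ∀ j < i, Commute (z i) (y j))
    (hge : ∀ j < m + 1, ∀ i ≤ j, ¬ Commute (z i) (y j)) :
    m ≤ k := by
  have key := hX.card_le (Finset.range m) (fun i => y i * z (i + 1)) ?_ ?_
  · simpa using key
  · intro i hi
    have hi := Finset.mem_range.mp hi
    exact hmul _ (hy i (by omega)) _ (hz _ (by omega)) (hlt _ (by omega) i (by omega)).symm
  · intro i hi j hj hij hcomm
    have hi := Finset.mem_range.mp hi
    have hj := Finset.mem_range.mp hj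
    have hyw : Commute (y i) (y j * z (j + 1)) :=
      (hyy i (by omega) j (by omega)).mul_right (hlt _ (by omega) i (by omega)).symm
    have h1 : Commute (z (i + 1)) (y j * z (j + 1)) := by
      have := hyw.inv_left.mul_left hcomm
      simpa using this
    have h2 : Commute (z (i + 1)) (y j) := by
      have := h1.mul_right (hzz (i + 1) (by omega) (j + 1) (by omega)).inv_right
      simpa using this
    exact hge j (by omega) (i + 1) (by omega) h2

end NoncommutingSets

/-- Descending chains of centralizers inside `X` have length bounded in terms of the size of
the pairwise noncommuting subsets of `X`. -/
theorem exists_centralizer_chain_bound (k : ℕ) : ∃ L : ℕ, ∀ (G : Type) [Group G] (X : Set G),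
    NoncommutingBound X k → CommutingMulClosed X → (1 : G) ∈ X →
    ∀ z y : ℕ → G, (∀ i < L, z i ∈ X) → (∀ i < L, y i ∈ X) →
      (∀ i < L, ∀ j < i, Commute (z i) (y j)) → (∀ i < L, ¬ Commute (z i) (y i)) → False := by
  obtain ⟨N₃, h₃⟩ := exists_ramsey_bound (k + 2) (k + 2)
  obtain ⟨N₂, h₂⟩ := exists_ramsey_bound N₃ (k + 1)
  obtain ⟨N₁, h₁⟩ := exists_ramsey_bound N₂ (k + 1)
  refine ⟨N₁, fun G _ X hX hmul hone z y hz hy hlt hd => ?_⟩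
  have hsymm : ∀ (w : ℕ → G) (B : Finset ℕ),
      (∀ i ∈ B, ∀ j ∈ B, i < j → Commute (w i) (w j)) →
      ∀ i ∈ B, ∀ j ∈ B, Commute (w i) (w j) := by
    intro w B h i hi j hj
    rcases lt_trichotomy i j with hij | rfl | hij
    · exact h i hi j hj hij
    · exact Commute.refl _
    · exact (h j hj i hi hij).symm
  rcases h₁ (Finset.range N₁) (fun i j => Commute (y i) (y j)) (by simp) with
    ⟨B₁, hB₁, hc₁, hyy⟩ | ⟨B, hB, hc, hn⟩
  swap
  · have := hX.card_le B y (fun i hi => hy i (Finset.mem_range.mp (hB hi))) hn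
    omega
  rcases h₂ B₁ (fun i j => Commute (z i) (z j)) hc₁ with ⟨B₂, hB₂, hc₂, hzz⟩ | ⟨B, hB, hc, hn⟩
  swap
  · have := hX.card_le B z (fun i hi => hz i (Finset.mem_range.mp (hB₁ (hB hi)))) hn
    omega
  replace hyy := hsymm y B₁ hyy
  replace hzz := hsymm z B₂ hzz
  have henum : ∀ B ⊆ B₂, k + 2 ≤ B.card → ∃ e : ℕ → ℕ, (∀ i < k + 2, e i ∈ B) ∧
      (∀ i < k + 2, e i ∈ B₂) ∧ (∀ i < k + 2, e i ∈ B₁) ∧ (∀ i < k + 2, e i < N₁) ∧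
      ∀ i j, i < j → j < k + 2 → e i < e j := by
    intro B hB hc
    obtain ⟨e, he, hmono⟩ := exists_increasing_enumeration B hc
    exact ⟨e, he, fun i hi => hB (he i hi), fun i hi => hB₂ (hB (he i hi)),
      fun i hi => Finset.mem_range.mp (hB₁ (hB₂ (hB (he i hi)))), hmono⟩
  rcases h₃ B₂ (fun i j => Commute (z i) (y j)) hc₂ with ⟨B, hB, hc, hn⟩ | ⟨B, hB, hc, hn⟩
  · obtain ⟨e, he, he₂, he₁, he₀, hmono⟩ := henum B hB hc
    have := hX.le_of_matching (m := k + 2) hmul hone (fun i => z (e i)) (fun i => y (e i))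
      (fun i hi => hz _ (he₀ i hi)) (fun i hi => hy _ (he₀ i hi))
      (fun i hi j hj => hzz _ (he₂ i hi) _ (he₂ j hj))
      (fun i hi j hj => hyy _ (he₁ i hi) _ (he₁ j hj))
      (fun i hi j hj hij => by
        rcases lt_or_gt_of_ne hij with h | h
        · exact hn _ (he i hi) _ (he j hj) (hmono i j h hj)
        · exact hlt _ (he₀ i hi) _ (hmono j i h hi))
      (fun i hi => hd _ (he₀ i hi))
    omega
  · obtain ⟨e, he, he₂, he₁, he₀, hmono⟩ := henum B hB hc
    have := hX.le_of_halfGraph (m := k + 1) hmul (fun i => z (e i)) (fun i => y (e i))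
      (fun i hi => hz _ (he₀ i hi)) (fun i hi => hy _ (he₀ i hi))
      (fun i hi j hj => hzz _ (he₂ i hi) _ (he₂ j hj))
      (fun i hi j hj => hyy _ (he₁ i hi) _ (he₁ j hj))
      (fun i hi j hij => hlt _ (he₀ i hi) _ (hmono j i hij hi))
      (fun j hj i hij => by
        rcases Nat.lt_or_ge i j with h | h
        · exact hn _ (he i (by omega)) _ (he j hj) (hmono i j h hj)
        · obtain rfl : i = j := by omega
          exact hd _ (he₀ i hj))
    omega

section Translates

variable {G : Type*} [Group G]

/-- The average size of `A ∩ h • A` over `h` in `G` is `|A|² / |G|`. -/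
theorem sum_card_inter_smul [Fintype G] [DecidableEq G] (A : Finset G) :
    ∑ h : G, (A ∩ h • A).card = A.card ^ 2 := by
  have h1 : ∀ h : G, (A ∩ h • A).card = ∑ g ∈ A, if h⁻¹ * g ∈ A then 1 else 0 := by
    intro h
    rw [← Finset.filter_mem_eq_inter, Finset.card_filter]
    refine Finset.sum_congr rfl fun g _ => ?_
    simp [← Finset.inv_smul_mem_iff]
  simp_rw [h1]
  rw [Finset.sum_comm]
  have h2 : ∀ g ∈ A, (∑ h : G, if h⁻¹ * g ∈ A then 1 else 0) = A.card := by
    intro g _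
    rw [← Finset.card_filter]
    refine Finset.card_bij' (fun h _ => h⁻¹ * g) (fun a _ => g * a⁻¹) ?_ ?_ ?_ ?_ <;> simp
  rw [Finset.sum_congr rfl h2]
  simp [sq]

/-- A dense subset of a group without proper subgroups of small index is everything or has a
smaller dense intersection with one of its translates. -/
theorem eq_univ_or_exists_dense_inter [Fintype G] [DecidableEq G] (A : Finset G) (a : ℕ)
    (hA : Fintype.card G ≤ a * A.card)
    (hG : ∀ H : Subgroup G, H.index ≤ 2 * a → H = ⊤) :
    A = Finset.univ ∨
      ∃ h : G, ¬ A ⊆ h • A ∧ Fintype.card G ≤ 2 * a ^ 2 * (A ∩ h • A).card := by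
  classical
  by_contra! hcon
  obtain ⟨hne, hsmall⟩ := hcon
  have hGpos : 0 < Fintype.card G := Fintype.card_pos
  have hApos : 0 < A.card := by
    rcases Nat.eq_zero_or_pos A.card with h | h
    · simp [h] at hA
    · exact h
  set N := MulAction.stabilizer G A
  have hsub : ∀ h : G, A ⊆ h • A → h ∈ N := fun h hh =>
    MulAction.mem_stabilizer_iff.mpr (Finset.eq_of_subset_of_card_le hh (by simp)).symm
  have hbound : ∀ h : G, 2 * a ^ 2 * (A ∩ h • A).card ≤
      (if h ∈ N then 2 * a ^ 2 * A.card else 0) + Fintype.card G := by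
    intro h
    split_ifs with hh
    · exact (Nat.mul_le_mul_left _ (Finset.card_le_card Finset.inter_subset_left)).trans
        (Nat.le_add_right _ _)
    · simpa using (hsmall h fun hs => hh (hsub h hs)).le
  have hsum := Finset.sum_le_sum fun h (_ : h ∈ Finset.univ) => hbound h
  rw [← Finset.mul_sum, sum_card_inter_smul, Finset.sum_add_distrib, ← Finset.sum_filter] at hsum
  have hNcard : (Finset.univ.filter (· ∈ N)).card = Nat.card N := by
    rw [Nat.card_eq_fintype_card, Fintype.card_subtype]
  simp only [Finset.sum_const, Finset.card_univ, smul_eq_mul, hNcard] at hsum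
  have hapos : 0 < a := by
    rcases Nat.eq_zero_or_pos a with h | h
    · simp [h] at hA
    · exact h
  have hsq : Fintype.card G * Fintype.card G ≤ a ^ 2 * A.card ^ 2 := by
    calc _ ≤ (a * A.card) * (a * A.card) := Nat.mul_le_mul hA hA
      _ = _ := by ring
  have h1 : a ^ 2 * A.card * A.card ≤ a ^ 2 * A.card * (2 * Nat.card N) := by nlinarith
  have h2 : A.card ≤ 2 * Nat.card N := Nat.le_of_mul_le_mul_left h1 (by positivity)
  have h3 : N.index * Nat.card N ≤ 2 * a * Nat.card N := by
    rw [N.index_mul_card, Nat.card_eq_fintype_card]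
    nlinarith
  have htop : N = ⊤ := hG N (Nat.le_of_mul_le_mul_right h3 Nat.card_pos)
  refine hne (Finset.eq_univ_of_forall fun g => ?_)
  obtain ⟨b, hb⟩ := Finset.card_pos.mp hApos
  have hg : g * b⁻¹ ∈ N := htop ▸ Subgroup.mem_top _
  have : (g * b⁻¹) • b ∈ (g * b⁻¹) • A := Finset.smul_mem_smul_finset hb
  rw [MulAction.mem_stabilizer_iff.mp hg] at this
  simpa using this

end Translates

theorem IsSimpleGroup.eq_top_of_index_le {G : Type*} [Group G] [Finite G] [IsSimpleGroup G]
    {m : ℕ} (hm : m.factorial < Nat.card G) (H : Subgroup G) (hH : H.index ≤ m) : H = ⊤ := by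
  rcases (inferInstance : H.normalCore.Normal).eq_bot_or_eq_top with h | h
  · rw [Subgroup.normalCore_eq_ker, MonoidHom.ker_eq_bot_iff] at h
    have h1 := Nat.card_le_card_of_injective _ h
    rw [Nat.card_perm] at h1
    have h2 : Nat.card (G ⧸ H) ≤ m := hH
    have := Nat.factorial_le h2
    omega
  · exact top_le_iff.mp (h ▸ H.normalCore_le)

/-- In a finite simple group that is large enough, a normal set closed under products of
commuting elements and containing a noncentral element has many noncommuting elements. -/
theorem exists_card_bound_of_noncommutingBound (k : ℕ) : ∃ N : ℕ, ∀ (G : Type) [Group G] [Finite G]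
    [IsSimpleGroup G] (X : Set G), NoncommutingBound X k → CommutingMulClosed X → (1 : G) ∈ X →
    (∀ x ∈ X, ∀ g : G, g * x * g⁻¹ ∈ X) → ∀ x ∈ X, x ∉ Subgroup.center G → Nat.card G ≤ N := by
  obtain ⟨L, hL⟩ := exists_centralizer_chain_bound k
  let a : ℕ → ℕ := fun n => Nat.rec k (fun _ b => 2 * b ^ 2) n
  refine ⟨∑ n ∈ Finset.range L, (2 * a n).factorial, fun G _ _ _ X hX hmul hone hconj x hx hxc => ?_⟩
  classical
  by_contra! hbig
  have := Fintype.ofFinite G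
  have hindex : ∀ n < L, ∀ H : Subgroup G, H.index ≤ 2 * a n → H = ⊤ := fun n hn =>
    IsSimpleGroup.eq_top_of_index_le (lt_of_le_of_lt (Finset.single_le_sum
      (f := fun n => (2 * a n).factorial) (fun _ _ => Nat.zero_le _) (Finset.mem_range.mpr hn)) hbig)
  let D : Set G → Finset G := fun Y =>
    Finset.univ.filter fun g => ∀ y ∈ Y, Commute (g * x * g⁻¹) y
  have hD : ∀ Y g, g ∈ D Y ↔ ∀ y ∈ Y, Commute (g * x * g⁻¹) y := fun Y g => by simp [D]
  have hsmul : ∀ Y (h g : G), g ∈ h • D Y ↔ ∀ y ∈ Y, Commute (g * x * g⁻¹) (h * y * h⁻¹) := by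
    intro Y h g
    rw [← Finset.inv_smul_mem_iff, hD]
    refine forall₂_congr fun y _ => ?_
    rw [← Commute.conj_iff h]
    simp [mul_assoc]
  have huniv : ∀ Y, (∃ y ∈ Y, y ∉ Subgroup.center G) → D Y ≠ Finset.univ := by
    rintro Y ⟨y, hy, hyc⟩ hu
    have hle : Subgroup.normalClosure {x} ≤ Subgroup.centralizer {y} := by
      refine (Subgroup.closure_le _).mpr fun c hc => ?_
      obtain ⟨b, hb, hbc⟩ := Group.mem_conjugatesOfSet_iff.mp hc
      rw [Set.mem_singleton_iff] at hb
      subst hb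
      obtain ⟨g, rfl⟩ := isConj_iff.mp hbc
      have := (hD Y g).mp (hu ▸ Finset.mem_univ g) y hy
      exact Subgroup.mem_centralizer_singleton_iff.mpr this
    have hxn : x ∈ Subgroup.normalClosure {x} := Subgroup.subset_normalClosure rfl
    have htop : Subgroup.normalClosure {x} = ⊤ := by
      rcases (Subgroup.normalClosure_normal (s := {x})).eq_bot_or_eq_top with h | h
      · rw [h, Subgroup.mem_bot] at hxn
        exact absurd (hxn ▸ Subgroup.one_mem _) hxc
      · exact h
    refine hyc (Subgroup.mem_center_iff.mpr fun g => ?_)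
    have hg : g ∈ Subgroup.centralizer {y} := hle (htop ▸ Subgroup.mem_top g)
    exact Subgroup.mem_centralizer_singleton_iff.mp hg
  have hstart : ∃ y ∈ X, y ∉ Subgroup.center G ∧ Fintype.card G ≤ k * (D {y}).card := by
    let F : Finset (Finset G) := Finset.univ.filter fun S =>
      (∀ s ∈ S, ∃ g : G, s = g * x * g⁻¹) ∧ ∀ s ∈ S, ∀ t ∈ S, s ≠ t → ¬ Commute s t
    obtain ⟨S, hSF, hmax⟩ := F.exists_max_image Finset.card ⟨∅, by simp [F]⟩
    obtain ⟨hSx, hSc⟩ := (Finset.mem_filter.mp hSF).2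
    have hSX : ∀ s ∈ S, s ∈ X := fun s hs => by
      obtain ⟨g, rfl⟩ := hSx s hs
      exact hconj x hx g
    have hSk := hX S hSX hSc
    have hcover : ∀ g : G, ∃ s ∈ S, Commute (g * x * g⁻¹) s := by
      intro g
      by_contra! hg
      have hgS : g * x * g⁻¹ ∉ S := fun h => hg _ h (Commute.refl _)
      have := hmax (insert (g * x * g⁻¹) S) (by
        refine Finset.mem_filter.mpr ⟨Finset.mem_univ _, ?_, ?_⟩
        · intro s hs
          rcases Finset.mem_insert.mp hs with rfl | hs
          · exact ⟨g, rfl⟩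
          · exact hSx s hs
        · intro s hs t ht hst
          rcases Finset.mem_insert.mp hs with rfl | hs <;>
            rcases Finset.mem_insert.mp ht with rfl | ht
          · exact absurd rfl hst
          · exact hg t ht
          · exact fun h => hg s hs h.symm
          · exact hSc s hs t ht hst)
      rw [Finset.card_insert_of_notMem hgS] at this
      omega
    have hSne : S.Nonempty := by
      obtain ⟨s, hs, _⟩ := hcover 1
      exact ⟨s, hs⟩
    obtain ⟨s, hs, hsmax⟩ := S.exists_max_image (fun s => (D {s}).card) hSne
    have hU : (Finset.univ : Finset G) ⊆ S.biUnion fun s => D {s} := fun g _ => by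
      obtain ⟨t, ht, hgt⟩ := hcover g
      exact Finset.mem_biUnion.mpr ⟨t, ht, (hD _ _).mpr fun y hy => by
        rw [Set.mem_singleton_iff] at hy
        exact hy ▸ hgt⟩
    refine ⟨s, hSX s hs, fun hsc => ?_, ?_⟩
    · obtain ⟨g, rfl⟩ := hSx s hs
      refine hxc ?_
      have := (inferInstance : (Subgroup.center G).Normal).conj_mem _ hsc g⁻¹
      simpa [mul_assoc] using this
    · calc Fintype.card G ≤ (S.biUnion fun s => D {s}).card := Finset.card_le_card hU
        _ ≤ S.card * (D {s}).card := Finset.card_biUnion_le_card_mul _ _ _ hsmax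
        _ ≤ k * (D {s}).card := Nat.mul_le_mul_right _ hSk
  have hchain : ∀ n ≤ L, ∃ (Y : Set G) (z y : ℕ → G), Y ⊆ X ∧ (∃ b ∈ Y, b ∉ Subgroup.center G) ∧
      Fintype.card G ≤ a n * (D Y).card ∧ (∀ i < n, z i ∈ X) ∧ (∀ i < n, y i ∈ Y) ∧
      (∀ i < n, ∀ j < i, Commute (z i) (y j)) ∧ ∀ i < n, ¬ Commute (z i) (y i) := by
    intro n
    induction n with
    | zero =>
      intro _
      obtain ⟨b, hb, hbc, hcard⟩ := hstart
      exact ⟨{b}, fun _ => 1, fun _ => 1, Set.singleton_subset_iff.mpr hb, ⟨b, rfl, hbc⟩, hcard,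
        by simp⟩
    | succ n ih =>
      intro hn
      obtain ⟨Y, z, y, hYX, ⟨b, hb, hbc⟩, hcard, hz, hy, hlt, hd⟩ := ih (by omega)
      rcases eq_univ_or_exists_dense_inter (D Y) (a n) hcard (hindex n (by omega)) with
        h | ⟨h, hsub, hdense⟩
      · exact absurd h (huniv Y ⟨b, hb, hbc⟩)
      obtain ⟨g, hgD, hgh⟩ := Finset.not_subset.mp hsub
      rw [hsmul] at hgh
      push Not at hgh
      obtain ⟨c, hcY, hgc⟩ := hgh
      rw [hD] at hgD
      refine ⟨Y ∪ (fun y => h * y * h⁻¹) '' Y, fun i => if i = n then g * x * g⁻¹ else z i,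
        fun i => if i = n then h * c * h⁻¹ else y i, ?_, ⟨b, Or.inl hb, hbc⟩, ?_, ?_, ?_, ?_, ?_⟩
      · rintro _ (hw | ⟨w, hw, rfl⟩)
        · exact hYX hw
        · exact hconj w (hYX hw) h
      · have : D (Y ∪ (fun y => h * y * h⁻¹) '' Y) = D Y ∩ h • D Y := by
          ext g
          rw [Finset.mem_inter, hsmul, hD, hD]
          simp only [Set.mem_union, or_imp, forall_and, Set.forall_mem_image]
        rw [this]
        exact hdense
      · intro i hi
        by_cases hin : i = n
        · simpa [hin] using hconj x hx g
        · simpa [hin] using hz i (by omega)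
      · intro i hi
        by_cases hin : i = n
        · simpa only [hin, if_true] using Set.mem_union_right Y (Set.mem_image_of_mem _ hcY)
        · simpa only [hin, if_false] using Set.mem_union_left _ (hy i (by omega))
      · intro i hi j hj
        have hjn : j ≠ n := by omega
        by_cases hin : i = n
        · simpa only [hin, hjn, if_true, if_false] using hgD _ (hy j (by omega))
        · simpa only [hin, hjn, if_false] using hlt i (by omega) j hj
      · intro i hi
        by_cases hin : i = n
        · simpa only [hin, if_true] using hgc
        · simpa only [hin, if_false] using hd i (by omega)
  obtain ⟨Y, z, y, hYX, -, -, hz, hy, hlt, hd⟩ := hchain L le_rfl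
  exact hL G X hX hmul hone z y hz (fun i hi => hYX (hy i hi)) hlt hd

/-- let `p` be a prime. For every `k` there is `N` such that every finite
simple group `G` with `p ∣ |G|` and `|G| > N` contains more than `k` pairwise
noncommuting `p`-elements. -/
theorem stmt18 (p : ℕ) (hp : p.Prime) :
    ∀ k : ℕ, ∃ N : ℕ, ∀ (G : Type) [Group G] [Finite G], IsSimpleGroup G →
      p ∣ Nat.card G → N < Nat.card G →
      ∃ S : Finset G, k < S.card ∧ (∀ x ∈ S, ∃ n : ℕ, orderOf x = p ^ n) ∧
        ∀ x ∈ S, ∀ y ∈ S, x ≠ y → x * y ≠ y * x := by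
  intro k
  obtain ⟨N, hN⟩ := exists_card_bound_of_noncommutingBound k
  refine ⟨N + p, fun G _ _ hG hpG hcard => ?_⟩
  by_contra! hcon
  have := Fact.mk hp
  obtain ⟨x, hx⟩ := exists_prime_orderOf_dvd_card' p hpG
  have hmem : ∀ g : G, (∃ n, orderOf g = p ^ n) ↔ ∃ n, g ^ p ^ n = 1 := fun g => by
    constructor
    · rintro ⟨n, hn⟩
      exact ⟨n, hn ▸ pow_orderOf_eq_one g⟩
    · rintro ⟨n, hn⟩
      obtain ⟨m, -, hm⟩ := (Nat.dvd_prime_pow hp).mp (orderOf_dvd_of_pow_eq_one hn)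
      exact ⟨m, hm⟩
  have hxc : x ∉ Subgroup.center G := by
    intro hxc
    rcases (inferInstance : (Subgroup.center G).Normal).eq_bot_or_eq_top with h | h
    · rw [h, Subgroup.mem_bot] at hxc
      rw [hxc, orderOf_one] at hx
      exact hp.one_lt.ne hx
    · have hcomm : ∀ a b : G, a * b = b * a := fun a b =>
        Subgroup.mem_center_iff.mp (h ▸ Subgroup.mem_top b) a
      let _ : CommGroup G := { ‹Group G› with mul_comm := hcomm }
      have hprime : (Nat.card G).Prime := IsSimpleGroup.prime_card
      have := (Nat.prime_dvd_prime_iff_eq hp hprime).mp hpG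
      omega
  refine absurd (hN G {g | ∃ n, orderOf g = p ^ n} ?_ ?_ ⟨0, by simp⟩ ?_ x ⟨1, by simpa using hx⟩ hxc)
    (by omega)
  · intro S hS hSc
    by_contra! hk
    obtain ⟨a, ha, b, hb, hab, h⟩ := hcon S hk hS
    exact hSc a ha b hb hab h
  · intro a ha b hb hab
    obtain ⟨m, hm⟩ := (hmem a).mp ha
    obtain ⟨n, hn⟩ := (hmem b).mp hb
    refine (hmem _).mpr ⟨m + n, ?_⟩
    rw [hab.mul_pow, pow_add, pow_mul, hm, mul_comm, pow_mul, hn]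
    simp
  · rintro a ⟨n, hn⟩ g
    refine ⟨n, ?_⟩
    rw [← hn, ← MulAut.conj_apply]
    exact MulEquiv.orderOf_eq _ a
end
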